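/- Let R be a commutative Noetherian ring and a, b ideals of R such that R/b has finite dimension d. Then P_{a,R/b} = { m a maximal ideal of R : there exists p ∈ Assh_R(R/b) with p ⊆ m and cd_{R_m}(a R_m, R_m/p R_m) = d }. -/

import Mathlib

/- Common definitions: local cohomology modules, cohomological dimension, module dimension,
secondary representations and attached primes. -/

open CategoryTheory TensorProduct

/-- The `i`-th local cohomology module `H^i_a(M)`, as a type with its `R`-module structure. -/
noncomputable def TopLC (R : Type) [CommRing R] (a : Ideal R) (i : ℕ)
    (M : Type) [AddCommGroup M] [Module R M] : Type :=
  ((localCohomology a i).obj (ModuleCat.of R M))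

noncomputable instance (R : Type) [CommRing R] (a : Ideal R) (i : ℕ)
    (M : Type) [AddCommGroup M] [Module R M] : AddCommGroup (TopLC R a i M) :=
  inferInstanceAs (AddCommGroup ((localCohomology a i).obj (ModuleCat.of R M)))

noncomputable instance (R : Type) [CommRing R] (a : Ideal R) (i : ℕ)
    (M : Type) [AddCommGroup M] [Module R M] : Module R (TopLC R a i M) :=
  inferInstanceAs (Module R ((localCohomology a i).obj (ModuleCat.of R M)))

/-- The cohomological dimension `cd_R(a, M) = sup { i | H^i_a(M) ≠ 0 }`,
with value `⊥` if all local cohomology modules vanish. -/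
noncomputable def cohDim (R : Type) [CommRing R] (a : Ideal R)
    (M : Type) [AddCommGroup M] [Module R M] : WithBot ℕ∞ :=
  sSup {n : WithBot ℕ∞ | ∃ i : ℕ, n = (i : ℕ) ∧ Nontrivial (TopLC R a i M)}

/-- The (Krull) dimension of a module, i.e. the Krull dimension of its support. -/
noncomputable def moduleDim (R : Type) [CommRing R]
    (M : Type) [AddCommGroup M] [Module R M] : WithBot ℕ∞ :=
  Order.krullDim (Module.support R M)

/-- `Assh_R M`: the associated primes `p` of `M` with `dim R/p = dim M`. -/
noncomputable def Assh (R : Type) [CommRing R]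
    (M : Type) [AddCommGroup M] [Module R M] : Set (Ideal R) :=
  { p | p ∈ associatedPrimes R M ∧ ringKrullDim (R ⧸ p) = moduleDim R M }

/-- A submodule `S` is secondary if `S ≠ 0` and every `r : R` acts on `S` either
surjectively or nilpotently. -/
def IsSecondarySub (R : Type) [CommRing R] {M : Type} [AddCommGroup M] [Module R M]
    (S : Submodule R M) : Prop :=
  S ≠ ⊥ ∧ ∀ r : R, (∀ m ∈ S, ∃ s ∈ S, r • s = m) ∨ (∃ n : ℕ, ∀ m ∈ S, r ^ n • m = 0)

/-- A module is representable if it is the (finite) sum of secondary submodules. -/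
def IsRepresentable (R : Type) [CommRing R] (M : Type) [AddCommGroup M] [Module R M] : Prop :=
  ∃ (n : ℕ) (S : Fin n → Submodule R M), (∀ i, IsSecondarySub R (S i)) ∧ (⨆ i, S i) = ⊤

/-- A minimal secondary representation: secondary submodules summing to the whole module,
with pairwise distinct attached primes, none contained in the sum of the others. -/
def IsMinimalRep (R : Type) [CommRing R] {M : Type} [AddCommGroup M] [Module R M]
    {n : ℕ} (S : Fin n → Submodule R M) : Prop :=
  (∀ i, IsSecondarySub R (S i)) ∧ (⨆ i, S i) = ⊤ ∧
    (Function.Injective fun i => (S i).annihilator.radical) ∧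
    ∀ j, ¬ (S j ≤ ⨆ i ∈ ({j}ᶜ : Set (Fin n)), S i)

/-- The attached primes of a module: the radicals of the annihilators of the terms of a
minimal secondary representation. -/
def AttachedPrimes (R : Type) [CommRing R] (M : Type) [AddCommGroup M] [Module R M] :
    Set (Ideal R) :=
  { p | ∃ (n : ℕ) (S : Fin n → Submodule R M), IsMinimalRep R S ∧
      ∃ i, p = (S i).annihilator.radical }

/-- `stab b N = ⟨b⟩N = ⋂ₙ bⁿN`. -/
def stab {R M : Type} [CommRing R] [AddCommGroup M] [Module R M]
    (b : Ideal R) (N : Submodule R M) : Submodule R M :=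
  ⨅ n : ℕ, b ^ n • N

/-- The set `P_{a,M}` of primes `p ⊇ Ann M + a` for which there is a prime `p*` in the
support of the completed localization `(M_p)^` over `(R_p)^` with `dim (R_p)^/p* = d`
and `dim (R_p)^/(a (R_p)^ + p*) = 0`. -/
noncomputable def Pset (R : Type) [CommRing R] (a : Ideal R)
    (M : Type) [AddCommGroup M] [Module R M] (d : ℕ) : Set (PrimeSpectrum R) :=
  fun p =>
    Module.annihilator R M ⊔ a ≤ p.asIdeal ∧
    ∃ q : PrimeSpectrum (AdicCompletion
        (IsLocalRing.maximalIdeal (Localization.AtPrime p.asIdeal))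
        (Localization.AtPrime p.asIdeal)),
      q ∈ Module.support
          (AdicCompletion (IsLocalRing.maximalIdeal (Localization.AtPrime p.asIdeal))
            (Localization.AtPrime p.asIdeal))
          (AdicCompletion (IsLocalRing.maximalIdeal (Localization.AtPrime p.asIdeal))
            (LocalizedModule p.asIdeal.primeCompl M)) ∧
      ringKrullDim (AdicCompletion (IsLocalRing.maximalIdeal (Localization.AtPrime p.asIdeal))
          (Localization.AtPrime p.asIdeal) ⧸ q.asIdeal) = (d : WithBot ℕ∞) ∧
      ringKrullDim (AdicCompletion (IsLocalRing.maximalIdeal (Localization.AtPrime p.asIdeal))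
          (Localization.AtPrime p.asIdeal) ⧸
          (Ideal.map (algebraMap (Localization.AtPrime p.asIdeal)
              (AdicCompletion (IsLocalRing.maximalIdeal (Localization.AtPrime p.asIdeal))
                (Localization.AtPrime p.asIdeal)))
            (Ideal.map (algebraMap R (Localization.AtPrime p.asIdeal)) a) ⊔ q.asIdeal)) =
        (0 : WithBot ℕ∞)

section LocalCohomologyTheory

open Limits

namespace LocCoh

section OldExt

variable {A : Type*} [Category A] [Abelian A]

/-- The functional on homology induced by a functional on chains that vanishes on boundaries. -/
noncomputable def homologyDesc (K : ChainComplex A ℕ) (n : ℕ) {T : A} (c : K.X n ⟶ T)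
    (hc : K.d (n + 1) n ≫ c = 0) : K.homology n ⟶ T :=
  K.homologyι n ≫ K.descOpcycles c (n + 1) (by simp) hc

lemma homologyDesc_surjective (K : ChainComplex A ℕ) (n : ℕ) {T : A} [Injective T]
    (h : K.homology n ⟶ T) :
    ∃ (c : K.X n ⟶ T) (hc : K.d (n + 1) n ≫ c = 0), homologyDesc K n c hc = h := by
  refine ⟨K.pOpcycles n ≫ Injective.factorThru h (K.homologyι n), ?_, ?_⟩
  · rw [K.d_pOpcycles_assoc, zero_comp]
  · unfold homologyDesc
    conv_rhs => rw [← Injective.comp_factorThru h (K.homologyι n)]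
    congr 1
    rw [← cancel_epi (K.pOpcycles n)]
    simp

lemma homologyDesc_eq_zero_iff (K : ChainComplex A ℕ) (n : ℕ) {T : A} [Injective T]
    (c : K.X n ⟶ T) (hc : K.d (n + 1) n ≫ c = 0) (j : ℕ) (hj : (ComplexShape.down ℕ).next n = j) :
    homologyDesc K n c hc = 0 ↔ ∃ g : K.X j ⟶ T, K.d n j ≫ g = c := by
  constructor
  · intro h
    let S := ShortComplex.mk (K.homologyι n) (K.fromOpcycles n j) (K.homologyι_comp_fromOpcycles n j)
    have hS : S.Exact := by
      apply S.exact_of_f_is_kernel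
      exact K.homologyIsKernel n j hj
    refine ⟨hS.descToInjective _ h, ?_⟩
    have := hS.comp_descToInjective _ h
    dsimp [S] at this
    rw [← K.p_fromOpcycles n j, Category.assoc, this]
    simp
  · rintro ⟨g, rfl⟩
    unfold homologyDesc
    have : K.descOpcycles (K.d n j ≫ g) (n + 1) (by simp) hc = K.fromOpcycles n j ≫ g := by
      rw [← cancel_epi (K.pOpcycles n)]
      simp
    rw [this, K.homologyι_comp_fromOpcycles_assoc, zero_comp]

lemma homologyMap_homologyDesc {K L : ChainComplex A ℕ} (φ : K ⟶ L) (n : ℕ) {T : A}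
    (c : L.X n ⟶ T) (hc : L.d (n + 1) n ≫ c = 0) (hc' : K.d (n + 1) n ≫ φ.f n ≫ c = 0) :
    HomologicalComplex.homologyMap φ n ≫ homologyDesc L n c hc =
      homologyDesc K n (φ.f n ≫ c) hc' := by
  unfold homologyDesc
  rw [HomologicalComplex.homologyι_naturality_assoc]
  congr 1
  rw [← cancel_epi (K.pOpcycles n)]
  simp

end OldExt

section OldExt

variable {R : Type} [CommRing R] {X X' : ModuleCat.{0} R}

/-- `Ext` obtained by deriving the first variable. -/
noncomputable abbrev OldExt (X Y : ModuleCat.{0} R) (n : ℕ) : ModuleCat.{0} R :=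
  ((Ext R (ModuleCat.{0} R) n).obj (Opposite.op X)).obj Y

/-- The functor `Hom(-, Y)`. -/
noncomputable abbrev homTo (Y : ModuleCat.{0} R) : ModuleCat.{0} R ⥤ (ModuleCat.{0} R)ᵒᵖ :=
  ((linearYoneda R (ModuleCat.{0} R)).obj Y).rightOp

/-- The functional on the chains of `Hom(P, Y)` attached to a cochain. -/
noncomputable def cochainFunctional (P : ChainComplex (ModuleCat.{0} R) ℕ) {Y : ModuleCat.{0} R}
    {n : ℕ} (c : P.X n ⟶ Y) :
    (((homTo Y).mapHomologicalComplex _).obj P).X n ⟶ Opposite.op (ModuleCat.of R R) :=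
  (ModuleCat.ofHom (LinearMap.toSpanSingleton R _ c) :
    ModuleCat.of R R ⟶ ModuleCat.of R (P.X n ⟶ Y)).op

lemma d_cochainFunctional (P : ChainComplex (ModuleCat.{0} R) ℕ) {Y : ModuleCat.{0} R}
    {n m : ℕ} (c : P.X n ⟶ Y) :
    (((homTo Y).mapHomologicalComplex _).obj P).d m n ≫ cochainFunctional P c =
      cochainFunctional P (P.d m n ≫ c) := by
  apply Quiver.Hom.unop_inj
  apply ModuleCat.hom_ext
  apply LinearMap.ext
  intro r
  change P.d m n ≫ (r • c) = r • (P.d m n ≫ c)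
  simp

lemma map_cochainFunctional {P Q : ChainComplex (ModuleCat.{0} R) ℕ} (φ : P ⟶ Q)
    {Y : ModuleCat.{0} R} {n : ℕ} (c : Q.X n ⟶ Y) :
    (((homTo Y).mapHomologicalComplex _).map φ).f n ≫ cochainFunctional Q c =
      cochainFunctional P (φ.f n ≫ c) := by
  apply Quiver.Hom.unop_inj
  apply ModuleCat.hom_ext
  apply LinearMap.ext
  intro r
  change φ.f n ≫ (r • c) = r • (φ.f n ≫ c)
  simp

lemma cochainFunctional_surjective {P : ChainComplex (ModuleCat.{0} R) ℕ}
    {Y : ModuleCat.{0} R} {n : ℕ} 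
    (t : (((homTo Y).mapHomologicalComplex _).obj P).X n ⟶ Opposite.op (ModuleCat.of R R)) :
    ∃ c : P.X n ⟶ Y, cochainFunctional P c = t := by
  refine ⟨(t.unop.hom : R →ₗ[R] (P.X n ⟶ Y)) 1, ?_⟩
  apply Quiver.Hom.unop_inj
  apply ModuleCat.hom_ext
  apply LinearMap.ext
  intro r
  change r • (t.unop.hom : R →ₗ[R] (P.X n ⟶ Y)) 1 = (t.unop.hom : R →ₗ[R] (P.X n ⟶ Y)) r
  rw [← map_smul]
  simp

lemma cochainFunctional_eq_zero {P : ChainComplex (ModuleCat.{0} R) ℕ}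
    {Y : ModuleCat.{0} R} {n : ℕ} (c : P.X n ⟶ Y) : cochainFunctional P c = 0 ↔ c = 0 := by
  constructor
  · intro h
    have : (((cochainFunctional P c).unop.hom : R →ₗ[R] (P.X n ⟶ Y)) 1) = 0 := by
      rw [h]; rfl
    change (1 : R) • c = 0 at this
    simpa using this
  · rintro rfl
    apply Quiver.Hom.unop_inj
    apply ModuleCat.hom_ext
    apply LinearMap.ext
    intro r
    change r • (0 : P.X n ⟶ Y) = 0
    simp

lemma cochainFunctional_injective {P : ChainComplex (ModuleCat.{0} R) ℕ}
    {Y : ModuleCat.{0} R} {n : ℕ} {c c' : P.X n ⟶ Y}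
    (h : cochainFunctional P c = cochainFunctional P c') : c = c' := by
  have : (((cochainFunctional P c).unop.hom : R →ₗ[R] (P.X n ⟶ Y)) 1) =
    (((cochainFunctional P c').unop.hom : R →ₗ[R] (P.X n ⟶ Y)) 1) := by rw [h]
  change (1 : R) • c = (1 : R) • c' at this
  simpa using this

variable {Y : ModuleCat.{0} R} {n : ℕ}

/-- Old `Ext` as homology. -/
noncomputable def oldExtIso (P : ProjectiveResolution X) (Y : ModuleCat.{0} R) (n : ℕ) :
    ((homTo Y).leftDerived n).obj X ≅
      (((homTo Y).mapHomologicalComplex _).obj P.complex).homology n :=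
  P.isoLeftDerivedObj (homTo Y) n

lemma oldExtIso_naturality (f : X ⟶ X') (P : ProjectiveResolution X) (Q : ProjectiveResolution X')
    (φ : P.complex ⟶ Q.complex) (comm : φ.f 0 ≫ Q.π.f 0 = P.π.f 0 ≫ f) :
    ((homTo Y).leftDerived n).map f ≫ (oldExtIso Q Y n).hom = (oldExtIso P Y n).hom ≫
      HomologicalComplex.homologyMap (((homTo Y).mapHomologicalComplex _).map φ) n :=
  ProjectiveResolution.isoLeftDerivedObj_hom_naturality f P Q φ comm (homTo Y) n

/-- The element of the old `Ext` attached to a functional. -/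
noncomputable def oldElt (t : ((homTo Y).leftDerived n).obj X ⟶ Opposite.op (ModuleCat.of R R)) :
    OldExt X Y n :=
  (t.unop.hom : R →ₗ[R] (((homTo Y).leftDerived n).obj X).unop) (1 : R)

lemma oldElt_surjective (e : OldExt X Y n) : ∃ t, oldElt t = e :=
  ⟨(ModuleCat.ofHom (LinearMap.toSpanSingleton R _ e) : ModuleCat.of R R ⟶ OldExt X Y n).op,
    one_smul R e⟩

lemma oldElt_zero : oldElt (0 : ((homTo Y).leftDerived n).obj X ⟶ _) = 0 := rfl

lemma oldElt_eq_zero_iff (t : ((homTo Y).leftDerived n).obj X ⟶ Opposite.op (ModuleCat.of R R)) :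
    oldElt t = 0 ↔ t = 0 := by
  constructor
  · intro h
    apply Quiver.Hom.unop_inj
    apply ModuleCat.hom_ext
    apply LinearMap.ext_ring
    exact h
  · rintro rfl
    exact oldElt_zero

lemma oldElt_map (f : X ⟶ X')
    (t : ((homTo Y).leftDerived n).obj X' ⟶ Opposite.op (ModuleCat.of R R)) :
    (((Ext R (ModuleCat.{0} R) n).map f.op).app Y).hom (oldElt t) =
      oldElt (((homTo Y).leftDerived n).map f ≫ t) := rfl

/-- The class in the old `Ext` of a cocycle. -/
noncomputable def oldMk (P : ProjectiveResolution X) (c : P.complex.X n ⟶ Y)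
    (hc : P.complex.d (n + 1) n ≫ c = 0) : OldExt X Y n :=
  oldElt ((oldExtIso P Y n).hom ≫
    homologyDesc _ n (cochainFunctional P.complex c)
      (by rw [d_cochainFunctional, hc, cochainFunctional_eq_zero]))

lemma oldMk_surjective (P : ProjectiveResolution X) (e : OldExt X Y n) :
    ∃ (c : P.complex.X n ⟶ Y) (hc : P.complex.d (n + 1) n ≫ c = 0), oldMk P c hc = e := by
  obtain ⟨t, rfl⟩ := oldElt_surjective e
  obtain ⟨c', hc', h⟩ := homologyDesc_surjective _ n ((oldExtIso P Y n).inv ≫ t)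
  obtain ⟨c, rfl⟩ := cochainFunctional_surjective c'
  have hc := hc'
  rw [d_cochainFunctional, cochainFunctional_eq_zero] at hc
  refine ⟨c, hc, ?_⟩
  unfold oldMk
  rw [h, Iso.hom_inv_id_assoc]

lemma oldMk_eq_zero_iff (P : ProjectiveResolution X) (c : P.complex.X n ⟶ Y)
    (hc : P.complex.d (n + 1) n ≫ c = 0) (j : ℕ) (hj : (ComplexShape.down ℕ).next n = j) :
    oldMk P c hc = 0 ↔ ∃ g : P.complex.X j ⟶ Y, P.complex.d n j ≫ g = c := by
  have key := homologyDesc_eq_zero_iff _ n (cochainFunctional P.complex c)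
    (by rw [d_cochainFunctional, hc, cochainFunctional_eq_zero]) j hj
  unfold oldMk
  rw [oldElt_eq_zero_iff, Preadditive.IsIso.comp_left_eq_zero, key]
  constructor
  · rintro ⟨g, hg⟩
    obtain ⟨g, rfl⟩ := cochainFunctional_surjective g
    rw [d_cochainFunctional] at hg
    exact ⟨g, cochainFunctional_injective hg⟩
  · rintro ⟨g, rfl⟩
    exact ⟨cochainFunctional _ g, d_cochainFunctional _ _⟩

lemma oldMk_map (f : X ⟶ X') (P : ProjectiveResolution X) (Q : ProjectiveResolution X')
    (φ : P.complex ⟶ Q.complex) (comm : φ.f 0 ≫ Q.π.f 0 = P.π.f 0 ≫ f)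
    (c : Q.complex.X n ⟶ Y) (hc : Q.complex.d (n + 1) n ≫ c = 0) :
    (((Ext R (ModuleCat.{0} R) n).map f.op).app Y).hom (oldMk Q c hc) =
      oldMk P (φ.f n ≫ c) (by rw [← φ.comm_assoc, hc, comp_zero]) := by
  unfold oldMk
  rw [oldElt_map, ← Category.assoc, oldExtIso_naturality f P Q φ comm, Category.assoc,
    homologyMap_homologyDesc _ _ _ _ (by rw [map_cochainFunctional, d_cochainFunctional,
      ← φ.comm_assoc, hc, comp_zero, cochainFunctional_eq_zero])]
  simp only [map_cochainFunctional]

end OldExt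

section Bridge

variable {R : Type} [CommRing R] {X X' Y : ModuleCat.{0} R} {n : ℕ}

lemma extMk_zero_degree (P : ProjectiveResolution X) (c : P.complex.X 0 ⟶ Y)
    (hc : P.complex.d (0 + 1) 0 ≫ c = 0) (h : P.extMk c (0 + 1) rfl hc = 0) : c = 0 := by
  simp only [← P.extEquivCohomologyClass.apply_eq_iff_eq,
    ProjectiveResolution.extEquivCohomologyClass_extMk,
    ProjectiveResolution.extEquivCohomologyClass_zero,
    CochainComplex.HomComplex.CohomologyClass.mk_eq_zero_iff] at h
  rw [CochainComplex.HomComplex.Cocycle.toSingleMk_mem_coboundaries_iff _ _ _ _ _ 1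
    (by simp)] at h
  obtain ⟨g, hg⟩ := h
  have hz : IsZero (P.cochainComplex.X 1) :=
    CochainComplex.isZero_of_isStrictlyLE P.cochainComplex 0 1 (by simp)
  rw [hz.eq_zero_of_src g, comp_zero] at hg
  have := hg.symm
  rwa [Preadditive.IsIso.comp_left_eq_zero] at this

lemma extMk_eq_zero_iff_oldMk (P : ProjectiveResolution X) (c : P.complex.X n ⟶ Y)
    (hc : P.complex.d (n + 1) n ≫ c = 0) :
    P.extMk c (n + 1) rfl hc = 0 ↔ oldMk P c hc = 0 := by
  obtain _ | n := n
  · rw [oldMk_eq_zero_iff P c hc 0 (by simp)]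
    constructor
    · intro h
      exact ⟨0, by rw [extMk_zero_degree P c hc h]; simp⟩
    · rintro ⟨g, rfl⟩
      simp
  · rw [oldMk_eq_zero_iff P c hc n (by simp), P.extMk_eq_zero_iff c _ rfl hc n rfl]

/-- The projection `R ⧸ a ^ n → R ⧸ a ^ m` as a morphism. -/
noncomputable def powProj (a : Ideal R) {m n : ℕ} (h : m ≤ n) :
    ModuleCat.of R (R ⧸ a ^ n) ⟶ ModuleCat.of R (R ⧸ a ^ m) :=
  ModuleCat.ofHom (Submodule.mapQ _ _ LinearMap.id (Ideal.pow_le_pow_right h))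

lemma powProj_self (a : Ideal R) (m : ℕ) : powProj a (le_refl m) = 𝟙 _ := by
  apply ModuleCat.hom_ext
  exact Submodule.mapQ_id _

lemma powProj_comp (a : Ideal R) {l m n : ℕ} (h : l ≤ m) (h' : m ≤ n) :
    powProj a h' ≫ powProj a h = powProj a (h.trans h') := by
  apply ModuleCat.hom_ext
  apply LinearMap.ext
  intro x
  obtain ⟨x, rfl⟩ := Submodule.Quotient.mk_surjective _ x
  rfl

/-- The transition maps of the system computing local cohomology. -/
noncomputable def extTrans (a : Ideal R) (i : ℕ) (Y : ModuleCat.{0} R) (m n : ℕ) (h : m ≤ n) :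
    Abelian.Ext (ModuleCat.of R (R ⧸ a ^ m)) Y i →ₗ[R]
      Abelian.Ext (ModuleCat.of R (R ⧸ a ^ n)) Y i :=
  Abelian.Ext.precompOfLinear (Abelian.Ext.mk₀ (powProj a h)) R Y (zero_add i)

lemma extTrans_apply (a : Ideal R) (i : ℕ) (Y : ModuleCat.{0} R) (m n : ℕ) (h : m ≤ n) 
    (x : Abelian.Ext (ModuleCat.of R (R ⧸ a ^ m)) Y i) :
    extTrans a i Y m n h x = (Abelian.Ext.mk₀ (powProj a h)).comp x (zero_add i) := rfl

instance (a : Ideal R) (i : ℕ) (Y : ModuleCat.{0} R) :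
    DirectedSystem (fun n => Abelian.Ext (ModuleCat.of R (R ⧸ a ^ n)) Y i)
      (fun m n h => extTrans a i Y m n h) where
  map_self m x := by
    simp [extTrans_apply, powProj_self]
  map_map k j i h h' x := by
    simp only [extTrans_apply]
    rw [← Abelian.Ext.comp_assoc (h := by simp) (h₁₂ := add_zero 0) (h₂₃ := by simp),
      Abelian.Ext.mk₀_comp_mk₀, powProj_comp]

/-- Local cohomology as a direct limit of `Ext` groups. -/
def LC (a : Ideal R) (i : ℕ) (M : Type) [AddCommGroup M] [Module R M] : Type :=
  Module.DirectLimit (fun n => Abelian.Ext (ModuleCat.of R (R ⧸ a ^ n)) (ModuleCat.of R M) i)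
    (extTrans a i (ModuleCat.of R M))

noncomputable instance (a : Ideal R) (i : ℕ) (M : Type) [AddCommGroup M] [Module R M] :
    AddCommGroup (LC a i M) :=
  inferInstanceAs (AddCommGroup (Module.DirectLimit _ _))

noncomputable instance (a : Ideal R) (i : ℕ) (M : Type) [AddCommGroup M] [Module R M] :
    Module R (LC a i M) :=
  inferInstanceAs (Module R (Module.DirectLimit _ _))

namespace LC

variable (a : Ideal R) (i : ℕ) (M : Type) [AddCommGroup M] [Module R M]

/-- The canonical map from an `Ext` module to local cohomology. -/
noncomputable def of (n : ℕ) :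
    Abelian.Ext (ModuleCat.of R (R ⧸ a ^ n)) (ModuleCat.of R M) i →ₗ[R] LC a i M :=
  Module.DirectLimit.of R ℕ _ (extTrans a i (ModuleCat.of R M)) n

variable {a i M}

lemma exists_of (x : LC a i M) : ∃ n e, of a i M n e = x :=
  Module.DirectLimit.exists_of x

lemma of_trans {m n : ℕ} (h : m ≤ n) (e) :
    of a i M n (extTrans a i (ModuleCat.of R M) m n h e) = of a i M m e :=
  Module.DirectLimit.of_f (hij := h)

lemma exists_trans_eq_zero {m : ℕ} {e} (he : of a i M m e = 0) :
    ∃ n, ∃ h : m ≤ n, extTrans a i (ModuleCat.of R M) m n h e = 0 :=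
  Module.DirectLimit.of.zero_exact he

end LC

lemma colimit_nontrivial_iff (F : ℕᵒᵖᵒᵖ ⥤ ModuleCat.{0} R) :
    Nontrivial (colimit F : ModuleCat.{0} R) ↔ ∃ (m : ℕ) (e : F.obj ⟨⟨m⟩⟩), ∀ (n : ℕ) (h : m ≤ n),
      (F.map (X := ⟨⟨m⟩⟩) (Y := ⟨⟨n⟩⟩) (homOfLE h).op.op).hom e ≠ 0 := by
  constructor
  · intro _
    obtain ⟨x, hx⟩ := exists_ne (0 : (colimit F : ModuleCat.{0} R))
    obtain ⟨j, e, rfl⟩ := Concrete.colimit_exists_rep F x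
    obtain ⟨⟨m⟩⟩ := j
    refine ⟨m, e, fun n h h0 => hx ?_⟩
    have h1 := congrArg (fun t => t.hom e)
      (colimit.w F (j := ⟨⟨n⟩⟩) (j' := ⟨⟨m⟩⟩) (homOfLE h).op.op)
    refine h1.symm.trans ?_
    change (colimit.ι F _).hom ((F.map _).hom e) = 0
    rw [h0, map_zero]
  · rintro ⟨m, e, he⟩
    refine ⟨(colimit.ι F ⟨⟨m⟩⟩).hom e, 0, fun h => ?_⟩
    obtain ⟨⟨⟨n⟩⟩, f, hf⟩ := Concrete.colimit_rep_eq_zero R F _ e h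
    exact he n (leOfHom f.unop.unop) hf

lemma topLC_nontrivial_iff_exists (a : Ideal R) (i : ℕ) (M : Type) [AddCommGroup M] [Module R M] :
    Nontrivial (TopLC R a i M) ↔ ∃ (m : ℕ) (e : OldExt (ModuleCat.of R (R ⧸ a ^ m))
      (ModuleCat.of R M) i), ∀ (n : ℕ) (h : m ≤ n),
        (((Ext R (ModuleCat.{0} R) i).map (powProj a h).op).app (ModuleCat.of R M)).hom e ≠ 0 := by
  let Y := ModuleCat.of R M
  let D := localCohomology.diagram (localCohomology.idealPowersDiagram a) i
  let F := D ⋙ (evaluation _ _).obj Y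
  have hF : Nontrivial (TopLC R a i M) ↔ Nontrivial (colimit F : ModuleCat.{0} R) :=
    (colimitObjIsoColimitCompEvaluation D Y).toLinearEquiv.toEquiv.nontrivial_congr
  rw [hF]
  rw [colimit_nontrivial_iff]
  constructor
  · rintro ⟨m, e, he⟩
    exact ⟨m, e, fun n h => he n h⟩
  · rintro ⟨m, e, he⟩
    exact ⟨m, e, fun n h => he n h⟩

lemma LC_nontrivial_iff_exists (a : Ideal R) (i : ℕ) (M : Type) [AddCommGroup M] [Module R M] :
    Nontrivial (LC a i M) ↔ ∃ (m : ℕ) (e : Abelian.Ext (ModuleCat.of R (R ⧸ a ^ m))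
      (ModuleCat.of R M) i), ∀ (n : ℕ) (h : m ≤ n),
        extTrans a i (ModuleCat.of R M) m n h e ≠ 0 := by
  constructor
  · intro _
    obtain ⟨x, hx⟩ := exists_ne (0 : LC a i M)
    obtain ⟨m, e, rfl⟩ := x.exists_of
    refine ⟨m, e, fun n h h0 => hx ?_⟩
    rw [← LC.of_trans h, h0, map_zero]
  · rintro ⟨m, e, he⟩
    refine ⟨LC.of a i M m e, 0, fun h => ?_⟩
    obtain ⟨n, h, h0⟩ := LC.exists_trans_eq_zero h
    exact he n h h0

theorem topLC_nontrivial_iff (a : Ideal R) (i : ℕ) (M : Type) [AddCommGroup M] [Module R M] :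
    Nontrivial (TopLC R a i M) ↔ Nontrivial (LC a i M) := by
  rw [topLC_nontrivial_iff_exists, LC_nontrivial_iff_exists]
  have key : ∀ {X X' Y : ModuleCat.{0} R} (f : X ⟶ X') (P : ProjectiveResolution X)
      (Q : ProjectiveResolution X') (c : Q.complex.X i ⟶ Y)
      (hc : Q.complex.d (i + 1) i ≫ c = 0),
      (((Ext R (ModuleCat.{0} R) i).map f.op).app Y).hom (oldMk Q c hc) = 0 ↔
        (Abelian.Ext.mk₀ f).comp (Q.extMk c (i + 1) rfl hc) (zero_add i) = 0 := by
    intro X X' Y f P Q c hc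
    let φ : ProjectiveResolution.Hom P Q f :=
      { hom := ProjectiveResolution.lift f P Q
        hom_f_zero_comp_π_f_zero := ProjectiveResolution.lift_commutes_zero f P Q }
    rw [oldMk_map f P Q φ.hom φ.hom_f_zero_comp_π_f_zero,
      ProjectiveResolution.mk₀_comp_extMk c _ rfl hc φ, extMk_eq_zero_iff_oldMk]
  constructor
  · rintro ⟨m, e, he⟩
    obtain ⟨c, hc, rfl⟩ := oldMk_surjective (projectiveResolution _) e
    refine ⟨m, (projectiveResolution _).extMk c (i + 1) rfl hc, fun n h => ?_⟩
    have := he n h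
    rwa [ne_eq, key _ (projectiveResolution _)] at this
  · rintro ⟨m, e, he⟩
    obtain ⟨c, hc, rfl⟩ := (projectiveResolution _).extMk_surjective e (i + 1) rfl
    refine ⟨m, oldMk _ c hc, fun n h => ?_⟩
    rw [ne_eq, key _ (projectiveResolution _)]
    exact he n h

end Bridge

section Exactness

variable {R : Type} [CommRing R] {a : Ideal R} {i : ℕ}
  {M N P : Type} [AddCommGroup M] [Module R M] [AddCommGroup N] [Module R N]
  [AddCommGroup P] [Module R P]

namespace LC

/-- The map on local cohomology induced by composition with an extension class. -/
noncomputable def post (a : Ideal R) {i j k : ℕ}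
    (β : Abelian.Ext (ModuleCat.of R M) (ModuleCat.of R N) k) (h : i + k = j) :
    LC a i M →ₗ[R] LC a j N :=
  Module.DirectLimit.map (fun n => Abelian.Ext.postcompOfLinear β R _ h) (by
    intro m n hmn
    ext e
    exact Abelian.Ext.comp_assoc (h := by lia) (h₁₂ := zero_add i) (h₂₃ := h) ..)

lemma post_of {i j k : ℕ}
    (β : Abelian.Ext (ModuleCat.of R M) (ModuleCat.of R N) k) (h : i + k = j) (n : ℕ)
    (e : Abelian.Ext (ModuleCat.of R (R ⧸ a ^ n)) (ModuleCat.of R M) i) :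
    post a β h (of a i M n e) = of a j N n (e.comp β h) :=
  Module.DirectLimit.map_apply_of ..

/-- Functoriality of local cohomology. -/
noncomputable def map (a : Ideal R) (i : ℕ) (f : M →ₗ[R] N) : LC a i M →ₗ[R] LC a i N :=
  post a (Abelian.Ext.mk₀ (ModuleCat.ofHom f)) (add_zero i)

lemma map_of (f : M →ₗ[R] N) (n : ℕ)
    (e : Abelian.Ext (ModuleCat.of R (R ⧸ a ^ n)) (ModuleCat.of R M) i) :
    map a i f (of a i M n e) =
      of a i N n (e.comp (Abelian.Ext.mk₀ (ModuleCat.ofHom f)) (add_zero i)) :=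
  post_of ..

lemma map_id : map a i (LinearMap.id : M →ₗ[R] M) = LinearMap.id := by
  ext x
  obtain ⟨n, e, rfl⟩ := x.exists_of
  rw [map_of]
  simp

lemma map_comp (f : M →ₗ[R] N) (g : N →ₗ[R] P) : map a i (g ∘ₗ f) = map a i g ∘ₗ map a i f := by
  ext x
  obtain ⟨n, e, rfl⟩ := x.exists_of
  rw [LinearMap.comp_apply, map_of, map_of, map_of]
  simp

lemma map_smul_id (r : R) :
    map a i (r • LinearMap.id : M →ₗ[R] M) = r • LinearMap.id := by
  ext x
  obtain ⟨n, e, rfl⟩ := x.exists_of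
  have : ModuleCat.ofHom (r • LinearMap.id : M →ₗ[R] M) = r • 𝟙 (ModuleCat.of R M) := rfl
  rw [map_of, this, Abelian.Ext.mk₀_smul, Abelian.Ext.comp_smul]
  simp

lemma map_zero : map a i (0 : M →ₗ[R] N) = 0 := by
  ext x
  obtain ⟨n, e, rfl⟩ := x.exists_of
  rw [map_of]
  simp

/-- The bundled short complex of an exact pair. -/
def shortComplex (f : M →ₗ[R] N) (g : N →ₗ[R] P) (hfg : Function.Exact f g) :
    ShortComplex (ModuleCat.{0} R) where
  X₁ := ModuleCat.of R M
  X₂ := ModuleCat.of R N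
  X₃ := ModuleCat.of R P
  f := ModuleCat.ofHom f
  g := ModuleCat.ofHom g
  zero := by
    apply ModuleCat.hom_ext
    exact hfg.linearMap_comp_eq_zero

lemma shortExact (f : M →ₗ[R] N) (g : N →ₗ[R] P) (hfg : Function.Exact f g)
    (hf : Function.Injective f) (hg : Function.Surjective g) :
    (shortComplex f g hfg).ShortExact where
  exact := (ShortComplex.ShortExact.moduleCat_exact_iff_function_exact _).mpr hfg
  mono_f := (ModuleCat.mono_iff_injective _).2 hf
  epi_g := (ModuleCat.epi_iff_surjective _).2 hg

lemma map_exact (f : M →ₗ[R] N) (g : N →ₗ[R] P) (hfg : Function.Exact f g)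
    (hf : Function.Injective f) (hg : Function.Surjective g) :
    Function.Exact (map a i f) (map a i g) := by
  intro x
  constructor
  · intro hx
    obtain ⟨n, e, rfl⟩ := x.exists_of
    rw [map_of] at hx
    obtain ⟨m, h, hm⟩ := exists_trans_eq_zero hx
    rw [extTrans_apply, ← Abelian.Ext.comp_assoc (h := by simp) (h₁₂ := zero_add i)
      (h₂₃ := by simp)] at hm
    obtain ⟨y, hy⟩ := Abelian.Ext.covariant_sequence_exact₂ _ (shortExact f g hfg hf hg) _ hm
    exact ⟨of a i M m y, (map_of f m y).trans ((congrArg _ hy).trans (of_trans h e))⟩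
  · rintro ⟨y, rfl⟩
    rw [← LinearMap.comp_apply, ← map_comp, hfg.linearMap_comp_eq_zero, map_zero]
    rfl

lemma exists_connecting (f : M →ₗ[R] N) (g : N →ₗ[R] P) (hfg : Function.Exact f g)
    (hf : Function.Injective f) (hg : Function.Surjective g) (a : Ideal R) (i : ℕ) :
    ∃ δ : LC a i P →ₗ[R] LC a (i + 1) M,
      Function.Exact (map a i g) δ ∧ Function.Exact δ (map a (i + 1) f) := by
  have hS := shortExact f g hfg hf hg
  let β : Abelian.Ext (ModuleCat.of R P) (ModuleCat.of R M) 1 := hS.extClass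
  refine ⟨post a β rfl, ?_, ?_⟩
  · intro x
    obtain ⟨n, e, rfl⟩ := x.exists_of
    constructor
    · intro hx
      rw [post_of] at hx
      obtain ⟨m, h, hm⟩ := exists_trans_eq_zero hx
      rw [extTrans_apply, ← Abelian.Ext.comp_assoc (h := by lia) (h₁₂ := zero_add i)
        (h₂₃ := by simp)] at hm
      obtain ⟨y, hy⟩ := Abelian.Ext.covariant_sequence_exact₃ _ hS _ _ hm
      exact ⟨of a i N m y, (map_of g m y).trans ((congrArg _ hy).trans (of_trans h e))⟩
    · rintro ⟨y, hy⟩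
      rw [← hy]
      obtain ⟨m, y, rfl⟩ := y.exists_of
      rw [map_of, post_of, Abelian.Ext.comp_assoc (h := by lia) (h₁₂ := add_zero i)
        (h₂₃ := zero_add 1)]
      have : (Abelian.Ext.mk₀ (ModuleCat.ofHom g)).comp β (zero_add 1) = 0 :=
        hS.comp_extClass
      rw [this]
      simp
  · intro x
    obtain ⟨n, e, rfl⟩ := x.exists_of
    constructor
    · intro hx
      rw [map_of] at hx
      obtain ⟨m, h, hm⟩ := exists_trans_eq_zero hx
      rw [extTrans_apply, ← Abelian.Ext.comp_assoc (h := by lia) (h₁₂ := zero_add _)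
        (h₂₃ := by simp)] at hm
      obtain ⟨y, hy⟩ := Abelian.Ext.covariant_sequence_exact₁ _ hS _ hm rfl
      exact ⟨of a i P m y, (post_of β rfl m y).trans ((congrArg _ hy).trans (of_trans h e))⟩
    · rintro ⟨y, hy⟩
      rw [← hy]
      obtain ⟨m, y, rfl⟩ := y.exists_of
      rw [post_of, map_of, Abelian.Ext.comp_assoc (h := by lia) (h₁₂ := rfl)
        (h₂₃ := add_zero 1)]
      have : β.comp (Abelian.Ext.mk₀ (ModuleCat.ofHom f)) (add_zero 1) = 0 :=
        hS.extClass_comp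
      rw [this]
      simp

lemma exists_pow_smul_eq_zero (x : LC a i M) : ∃ n : ℕ, ∀ r ∈ a ^ n, r • x = 0 := by
  obtain ⟨n, e, rfl⟩ := x.exists_of
  refine ⟨n, fun r hr => ?_⟩
  rw [← map_smul]
  have h0 : r • 𝟙 (ModuleCat.of R (R ⧸ a ^ n)) = 0 := by
    apply ModuleCat.hom_ext
    apply LinearMap.ext
    intro y
    obtain ⟨y, rfl⟩ := Submodule.Quotient.mk_surjective _ y
    change r • (Submodule.Quotient.mk y : R ⧸ a ^ n) = 0
    rw [← Submodule.Quotient.mk_smul, Submodule.Quotient.mk_eq_zero]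
    exact Ideal.mul_mem_right _ _ hr
  have : r • e = 0 := by
    rw [← Abelian.Ext.mk₀_id_comp e, ← Abelian.Ext.smul_comp, ← Abelian.Ext.mk₀_smul, h0]
    simp
  rw [this, _root_.map_zero]

lemma subsingleton_of_injective [Module.Injective R M] : Subsingleton (LC a (i + 1) M) := by
  refine ⟨fun x y => ?_⟩
  have : CategoryTheory.Injective (ModuleCat.of R M) :=
    Module.injective_object_of_injective_module R M
  have key : ∀ x : LC a (i + 1) M, x = 0 := by
    intro x
    obtain ⟨n, e, rfl⟩ := x.exists_of
    rw [e.eq_zero_of_injective, _root_.map_zero]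
  rw [key x, key y]

end LC

end Exactness

/-- The submodule of elements killed by a power of `a`. -/
def torsion {R : Type} [CommRing R] (a : Ideal R) (M : Type) [AddCommGroup M] [Module R M] :
    Submodule R M where
  carrier := {x | ∃ n : ℕ, ∀ r ∈ a ^ n, r • x = 0}
  zero_mem' := ⟨0, by simp⟩
  add_mem' := by
    rintro x y ⟨m, hm⟩ ⟨n, hn⟩
    refine ⟨m + n, fun r hr => ?_⟩
    rw [smul_add, hm r (Ideal.pow_le_pow_right (Nat.le_add_right _ _) hr),
      hn r (Ideal.pow_le_pow_right (Nat.le_add_left _ _) hr), add_zero]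
  smul_mem' := by
    rintro c x ⟨n, hn⟩
    exact ⟨n, fun r hr => by rw [smul_comm, hn r hr, smul_zero]⟩

section Degree0

variable {R : Type} [CommRing R] {a : Ideal R} {i : ℕ}
  {M N P : Type} [AddCommGroup M] [Module R M] [AddCommGroup N] [Module R N]
  [AddCommGroup P] [Module R P]

lemma mem_torsion {x : M} : x ∈ torsion a M ↔ ∃ n : ℕ, ∀ r ∈ a ^ n, r • x = 0 := Iff.rfl

namespace LC

/-- Evaluation at `1` of an extension class of degree zero. -/
noncomputable def evalOne (I : Ideal R) (M : Type) [AddCommGroup M] [Module R M] :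
    Abelian.Ext (ModuleCat.of R (R ⧸ I)) (ModuleCat.of R M) 0 →ₗ[R] M :=
  (LinearMap.applyₗ (Submodule.Quotient.mk (1 : R) : R ⧸ I)) ∘ₗ
    (ModuleCat.homLinearEquiv (S := R)).toLinearMap ∘ₗ
      (Abelian.Ext.linearEquiv₀ (R := R)).toLinearMap

lemma evalOne_mk₀ (I : Ideal R) (f : R ⧸ I →ₗ[R] M) :
    evalOne I M (Abelian.Ext.mk₀ (ModuleCat.ofHom f)) = f (Submodule.Quotient.mk 1) := by
  have : Abelian.Ext.linearEquiv₀ (R := R) (Abelian.Ext.mk₀ (ModuleCat.ofHom f)) =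
      ModuleCat.ofHom f :=
    (Abelian.Ext.mk₀_bijective _ _).1 (Abelian.Ext.mk₀_linearEquiv₀_apply _)
  change (Abelian.Ext.linearEquiv₀ (R := R) (Abelian.Ext.mk₀ (ModuleCat.ofHom f))).hom _ = _
  rw [this]
  rfl

lemma exists_mk₀ (I : Ideal R)
    (e : Abelian.Ext (ModuleCat.of R (R ⧸ I)) (ModuleCat.of R M) 0) :
    ∃ f : R ⧸ I →ₗ[R] M, e = Abelian.Ext.mk₀ (ModuleCat.ofHom f) := by
  obtain ⟨f, rfl⟩ := (Abelian.Ext.mk₀_bijective _ _).2 e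
  exact ⟨f.hom, rfl⟩

lemma evalOne_extTrans {m n : ℕ} (h : m ≤ n)
    (e : Abelian.Ext (ModuleCat.of R (R ⧸ a ^ m)) (ModuleCat.of R M) 0) :
    evalOne (a ^ n) M (extTrans a 0 _ m n h e) = evalOne (a ^ m) M e := by
  obtain ⟨f, rfl⟩ := exists_mk₀ _ e
  rw [extTrans_apply, Abelian.Ext.mk₀_comp_mk₀, evalOne_mk₀]
  exact evalOne_mk₀ (a ^ n) (f ∘ₗ (powProj a h).hom)

lemma evalOne_injective (I : Ideal R) : Function.Injective (evalOne I M) := by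
  rw [injective_iff_map_eq_zero]
  intro e he
  obtain ⟨f, rfl⟩ := exists_mk₀ _ e
  rw [evalOne_mk₀] at he
  have : f = 0 := by
    apply LinearMap.ext
    intro y
    obtain ⟨y, rfl⟩ := Submodule.Quotient.mk_surjective _ y
    have h1 : (Submodule.Quotient.mk y : R ⧸ I) = y • Submodule.Quotient.mk 1 := by
      rw [← Submodule.Quotient.mk_smul, smul_eq_mul, mul_one]
    rw [h1, map_smul, he, smul_zero, LinearMap.zero_apply]
  rw [this]
  simp

/-- The embedding of `H^0_a(M)` into `M`. -/
noncomputable def zeroEmb (a : Ideal R) (M : Type) [AddCommGroup M] [Module R M] :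
    LC a 0 M →ₗ[R] M :=
  Module.DirectLimit.lift R ℕ _ _ (fun n => evalOne (a ^ n) M)
    (fun _ _ h e => evalOne_extTrans h e)

lemma zeroEmb_of (n : ℕ) (e) : zeroEmb a M (of a 0 M n e) = evalOne (a ^ n) M e :=
  Module.DirectLimit.lift_of ..

lemma zeroEmb_injective : Function.Injective (zeroEmb a M) := by
  rw [injective_iff_map_eq_zero]
  intro x hx
  obtain ⟨n, e, rfl⟩ := x.exists_of
  rw [zeroEmb_of] at hx
  rw [evalOne_injective (a ^ n) (hx.trans (_root_.map_zero _).symm), _root_.map_zero]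

lemma zeroEmb_map (f : M →ₗ[R] N) (x : LC a 0 M) :
    zeroEmb a N (map a 0 f x) = f (zeroEmb a M x) := by
  obtain ⟨n, e, rfl⟩ := x.exists_of
  obtain ⟨g, rfl⟩ := exists_mk₀ _ e
  rw [map_of, zeroEmb_of, zeroEmb_of, evalOne_mk₀, Abelian.Ext.mk₀_comp_mk₀]
  exact evalOne_mk₀ (a ^ n) (f ∘ₗ g)

lemma exists_zeroEmb_eq_iff (x : M) : (∃ y, zeroEmb a M y = x) ↔ x ∈ torsion a M := by
  constructor
  · rintro ⟨y, rfl⟩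
    obtain ⟨n, hn⟩ := y.exists_pow_smul_eq_zero
    exact ⟨n, fun r hr => by rw [← map_smul, hn r hr, _root_.map_zero]⟩
  · rintro ⟨n, hn⟩
    refine ⟨of a 0 M n (Abelian.Ext.mk₀ (ModuleCat.ofHom
      ((a ^ n).liftQ (LinearMap.toSpanSingleton R M x) fun r hr => ?_))), ?_⟩
    · exact hn r hr
    · rw [zeroEmb_of, evalOne_mk₀]
      change (1 : R) • x = x
      rw [one_smul]

lemma subsingleton_zero_iff : Subsingleton (LC a 0 M) ↔ torsion a M = ⊥ := by
  constructor
  · intro h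
    rw [eq_bot_iff]
    intro x hx
    obtain ⟨y, rfl⟩ := (exists_zeroEmb_eq_iff x).2 hx
    rw [Subsingleton.elim y 0, _root_.map_zero]
    exact zero_mem _
  · intro h
    refine ⟨fun x y => zeroEmb_injective ?_⟩
    have hx := (exists_zeroEmb_eq_iff (a := a) _).1 ⟨x, rfl⟩
    have hy := (exists_zeroEmb_eq_iff (a := a) _).1 ⟨y, rfl⟩
    rw [h, Submodule.mem_bot] at hx hy
    rw [hx, hy]

lemma map_zero_surjective_iff (g : N →ₗ[R] P) :
    Function.Surjective (map a 0 g) ↔ ∀ x ∈ torsion a P, ∃ y ∈ torsion a N, g y = x := by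
  constructor
  · intro h x hx
    obtain ⟨x, rfl⟩ := (exists_zeroEmb_eq_iff _).2 hx
    obtain ⟨y, rfl⟩ := h x
    exact ⟨zeroEmb a N y, (exists_zeroEmb_eq_iff _).1 ⟨y, rfl⟩, (zeroEmb_map g y).symm⟩
  · intro h x
    obtain ⟨y, hy, hyx⟩ := h _ ((exists_zeroEmb_eq_iff _).1 ⟨x, rfl⟩)
    obtain ⟨y, rfl⟩ := (exists_zeroEmb_eq_iff _).2 hy
    exact ⟨y, zeroEmb_injective ((zeroEmb_map g y).trans hyx)⟩

section Sequences

variable {f : M →ₗ[R] N} {g : N →ₗ[R] P} (hfg : Function.Exact f g)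
  (hf : Function.Injective f) (hg : Function.Surjective g)
include hfg hf hg

lemma subsingleton_mid (h₁ : Subsingleton (LC a i M)) (h₃ : Subsingleton (LC a i P)) :
    Subsingleton (LC a i N) := by
  refine subsingleton_of_forall_eq 0 fun x => ?_
  obtain ⟨y, rfl⟩ := (map_exact f g hfg hf hg x).1 (Subsingleton.elim _ _)
  rw [Subsingleton.elim y 0, _root_.map_zero]

lemma subsingleton_left (h₃ : Subsingleton (LC a i P)) (h₂ : Subsingleton (LC a (i + 1) N)) :
    Subsingleton (LC a (i + 1) M) := by
  obtain ⟨δ, _, h⟩ := exists_connecting f g hfg hf hg a i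
  refine subsingleton_of_forall_eq 0 fun x => ?_
  obtain ⟨y, rfl⟩ := (h x).1 (Subsingleton.elim _ _)
  rw [Subsingleton.elim y 0, _root_.map_zero]

lemma subsingleton_right (h₂ : Subsingleton (LC a i N)) (h₁ : Subsingleton (LC a (i + 1) M)) :
    Subsingleton (LC a i P) := by
  obtain ⟨δ, h, _⟩ := exists_connecting f g hfg hf hg a i
  refine subsingleton_of_forall_eq 0 fun x => ?_
  obtain ⟨y, rfl⟩ := (h x).1 (Subsingleton.elim _ _)
  rw [Subsingleton.elim y 0, _root_.map_zero]

lemma map_surjective (h₁ : Subsingleton (LC a (i + 1) M)) :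
    Function.Surjective (map a i g) := by
  obtain ⟨δ, h, _⟩ := exists_connecting f g hfg hf hg a i
  exact fun x => (h x).1 (Subsingleton.elim _ _)

lemma map_injective (h₃ : Subsingleton (LC a i P)) :
    Function.Injective (map a (i + 1) f) := by
  obtain ⟨δ, _, h⟩ := exists_connecting f g hfg hf hg a i
  rw [injective_iff_map_eq_zero]
  intro x hx
  obtain ⟨y, rfl⟩ := (h x).1 hx
  rw [Subsingleton.elim y 0, _root_.map_zero]

lemma subsingleton_of_map_surjective (h₂ : Subsingleton (LC a (i + 1) N))
    (hs : Function.Surjective (map a i g)) : Subsingleton (LC a (i + 1) M) := by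
  obtain ⟨δ, h', h⟩ := exists_connecting f g hfg hf hg a i
  refine subsingleton_of_forall_eq 0 fun x => ?_
  obtain ⟨y, rfl⟩ := (h x).1 (Subsingleton.elim _ _)
  obtain ⟨z, rfl⟩ := hs y
  exact (h' _).2 ⟨z, rfl⟩

end Sequences

/-- Local cohomology is invariant under isomorphisms. -/
noncomputable def congr (a : Ideal R) (i : ℕ) (e : M ≃ₗ[R] N) : LC a i M ≃ₗ[R] LC a i N :=
  LinearEquiv.ofLinearMap (map a i e.toLinearMap) (map a i e.symm.toLinearMap)
    (by rw [← map_comp, e.comp_symm, map_id]) (by rw [← map_comp, e.symm_comp, map_id])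

lemma map_lsmul (r : R) (x : LC a i M) : map a i (LinearMap.lsmul R M r) x = r • x := by
  have : LinearMap.lsmul R M r = r • LinearMap.id := rfl
  rw [this, map_smul_id]
  rfl

lemma smul_eq_zero_of_smul_eq_zero {r : R} (h : ∀ x : M, r • x = 0) (x : LC a i M) :
    r • x = 0 := by
  have : LinearMap.lsmul R M r = 0 := by ext x; exact h x
  rw [← map_lsmul, this, map_zero]
  rfl

instance subsingleton_of_subsingleton [Subsingleton M] : Subsingleton (LC a i M) := by
  refine subsingleton_of_forall_eq 0 fun x => ?_
  rw [← one_smul R x]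
  exact smul_eq_zero_of_smul_eq_zero (fun _ => Subsingleton.elim _ _) x

end LC

lemma exists_injective_embedding (R : Type) [CommRing R] (M : Type) [AddCommGroup M]
    [Module R M] : ∃ (J : Type) (_ : AddCommGroup J) (_ : Module R J) (f : M →ₗ[R] J),
      Module.Injective R J ∧ Function.Injective f := by
  let J := CategoryTheory.Injective.under (ModuleCat.of R M)
  refine ⟨J, inferInstance, inferInstance, (CategoryTheory.Injective.ι (ModuleCat.of R M)).hom,
    ?_, ?_⟩
  · have : CategoryTheory.Injective (ModuleCat.of R J) :=
      inferInstanceAs (CategoryTheory.Injective J)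
    exact Module.injective_module_of_injective_object R J
  · exact (ModuleCat.mono_iff_injective _).1 inferInstance

end Degree0

section Torsion

variable {R : Type} [CommRing R] [IsNoetherianRing R] (a : Ideal R)

lemma injective_torsion (J : Type) [AddCommGroup J] [Module R J] [Module.Injective R J] :
    Module.Injective R (torsion a J) := by
  rw [← Module.Baer.iff_injective]
  intro I f
  obtain ⟨n, hn⟩ : ∃ n : ℕ, ∀ r ∈ a ^ n, ∀ y : I, r • f y = 0 := by
    obtain ⟨s, hs⟩ := (Module.Finite.fg_top (R := R) (M := I))
    choose k hk using fun y : I => (f y).2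
    refine ⟨s.sup k, fun r hr y => ?_⟩
    have hy : y ∈ Submodule.span R (s : Set I) := hs ▸ Submodule.mem_top
    induction hy using Submodule.span_induction with
    | mem y hy =>
      exact Subtype.ext (hk y r (Ideal.pow_le_pow_right (Finset.le_sup hy) hr))
    | zero => simp
    | add y z _ _ h1 h2 => rw [map_add, smul_add, h1, h2, add_zero]
    | smul c y _ h => rw [map_smul, smul_comm, h, smul_zero]
  obtain ⟨k, hk⟩ := Ideal.exists_pow_inf_eq_pow_smul a I
  have hk' : ∀ y : I, (y : R) ∈ a ^ (n + k) → f y = 0 := by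
    intro y hy
    have h1 : (y : R) ∈ a ^ n • I := by
      have := hk (n + k) (by lia)
      have h2 : (y : R) ∈ a ^ (n + k) • ⊤ ⊓ I := ⟨by simpa using hy, y.2⟩
      rw [this, Nat.add_sub_cancel] at h2
      exact Submodule.smul_mono le_rfl inf_le_right h2
    have h3 : a ^ n • (⊤ : Submodule R I) ≤ LinearMap.ker f :=
      Submodule.smul_le.2 fun r hr y _ => by
        rw [LinearMap.mem_ker, map_smul, hn r hr]
    exact h3 ((Submodule.mem_smul_top_iff _ _ _).2 h1)
  let A := a ^ (n + k)
  let ι : (I ⧸ Submodule.comap I.subtype A) →ₗ[R] R ⧸ A := Submodule.mapQ _ _ I.subtype le_rfl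
  have hι : Function.Injective ι := by
    rw [← LinearMap.ker_eq_bot, Submodule.ker_mapQ, Submodule.mkQ_map_self]
  let F : (I ⧸ Submodule.comap I.subtype A) →ₗ[R] J :=
    Submodule.liftQ _ ((torsion a J).subtype ∘ₗ f) (fun y hy => by
      rw [LinearMap.mem_ker, LinearMap.comp_apply, hk' y hy, map_zero])
  obtain ⟨h, hh⟩ := Module.Injective.out ι hι F
  have hx : h (Submodule.Quotient.mk 1) ∈ torsion a J := by
    refine ⟨n + k, fun r hr => ?_⟩
    rw [← map_smul, ← Submodule.Quotient.mk_smul, smul_eq_mul, mul_one,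
      (Submodule.Quotient.mk_eq_zero _).2 hr, map_zero]
  refine ⟨LinearMap.toSpanSingleton R _ ⟨_, hx⟩, fun y hy => Subtype.ext ?_⟩
  change y • h (Submodule.Quotient.mk 1) = _
  rw [← map_smul, ← Submodule.Quotient.mk_smul, smul_eq_mul, mul_one]
  exact hh (Submodule.Quotient.mk ⟨y, hy⟩)

/-- Every module with `a`-power torsion embeds in an injective one. -/
lemma exists_torsion_injective_embedding (M : Type) [AddCommGroup M] [Module R M]
    (hM : torsion a M = ⊤) :
    ∃ (J : Type) (_ : AddCommGroup J) (_ : Module R J) (f : M →ₗ[R] J),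
      Module.Injective R J ∧ Function.Injective f ∧ torsion a J = ⊤ := by
  obtain ⟨J, _, _, f, _, hf⟩ := exists_injective_embedding R M
  refine ⟨torsion a J, inferInstance, inferInstance, f.codRestrict _ fun x => ?_,
    injective_torsion a J, ?_, ?_⟩
  · obtain ⟨n, hn⟩ := (hM ▸ Submodule.mem_top : x ∈ torsion a M)
    exact ⟨n, fun r hr => by rw [← map_smul, hn r hr, map_zero]⟩
  · exact fun x y h => hf (congrArg Subtype.val h)
  · rw [eq_top_iff]
    rintro ⟨x, n, hn⟩ -
    exact ⟨n, fun r hr => Subtype.ext (hn r hr)⟩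

omit [IsNoetherianRing R] in
variable {a} in
lemma torsion_eq_top_of_surjective {M N : Type} [AddCommGroup M] [Module R M] [AddCommGroup N]
    [Module R N] (g : M →ₗ[R] N) (hg : Function.Surjective g) (hM : torsion a M = ⊤) :
    torsion a N = ⊤ := by
  rw [eq_top_iff]
  intro x _
  obtain ⟨x, rfl⟩ := hg x
  obtain ⟨n, hn⟩ := (hM ▸ Submodule.mem_top : x ∈ torsion a M)
  exact ⟨n, fun r hr => by rw [← map_smul, hn r hr, map_zero]⟩

lemma LC.subsingleton_of_torsion_eq_top (i : ℕ) (M : Type) [AddCommGroup M] [Module R M]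
    (hM : torsion a M = ⊤) : Subsingleton (LC a (i + 1) M) := by
  induction i generalizing M with
  | zero =>
    obtain ⟨J, _, _, f, _, hf, hJ⟩ := exists_torsion_injective_embedding a M hM
    refine subsingleton_of_map_surjective (LinearMap.exact_map_mkQ_range f) hf
      (Submodule.mkQ_surjective _) subsingleton_of_injective ?_
    rw [map_zero_surjective_iff]
    intro x _
    obtain ⟨y, rfl⟩ := Submodule.mkQ_surjective _ x
    exact ⟨y, hJ ▸ Submodule.mem_top, rfl⟩
  | succ i ih =>
    obtain ⟨J, _, _, f, _, hf, hJ⟩ := exists_torsion_injective_embedding a M hM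
    exact subsingleton_left (LinearMap.exact_map_mkQ_range f) hf
      (Submodule.mkQ_surjective _)
      (ih _ (torsion_eq_top_of_surjective _ (Submodule.mkQ_surjective _) hJ))
      subsingleton_of_injective

end Torsion

section Vanishing

open Pointwise

variable {R : Type} [CommRing R] [IsNoetherianRing R] (a : Ideal R)
  (M : Type) [AddCommGroup M] [Module R M]

omit [IsNoetherianRing R] in
lemma exists_pow_smul_eq_zero [Module.Finite R M] (h : torsion a M = ⊤) :
    ∃ n : ℕ, ∀ r ∈ a ^ n, ∀ x : M, r • x = 0 := by
  obtain ⟨s, hs⟩ := (Module.Finite.fg_top (R := R) (M := M))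
  choose k hk using fun y : M => (h ▸ Submodule.mem_top : y ∈ torsion a M)
  refine ⟨s.sup k, fun r hr y => ?_⟩
  have hy : y ∈ Submodule.span R (s : Set M) := hs ▸ Submodule.mem_top
  induction hy using Submodule.span_induction with
  | mem y hy => exact hk y r (Ideal.pow_le_pow_right (Finset.le_sup hy) hr)
  | zero => simp
  | add y z _ _ h1 h2 => rw [smul_add, h1, h2, add_zero]
  | smul c y _ h => rw [smul_comm, h, smul_zero]

omit [IsNoetherianRing R] in
lemma torsion_torsion : torsion a (torsion a M) = ⊤ := by
  rw [eq_top_iff]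
  rintro ⟨x, n, hn⟩ -
  exact ⟨n, fun r hr => Subtype.ext (hn r hr)⟩

lemma torsion_quotient_torsion : torsion a (M ⧸ torsion a M) = ⊥ := by
  rw [eq_bot_iff]
  intro x hx
  obtain ⟨x, rfl⟩ := Submodule.mkQ_surjective _ x
  obtain ⟨n, hn⟩ := hx
  have h1 : ∀ r ∈ a ^ n, r • x ∈ torsion a M := fun r hr => by
    have := hn r hr
    rwa [← map_smul, Submodule.mkQ_apply, Submodule.Quotient.mk_eq_zero] at this
  let L : ↥(a ^ n) →ₗ[R] torsion a M :=
    ((LinearMap.toSpanSingleton R M x) ∘ₗ (a ^ n).subtype).codRestrict _ fun r => h1 _ r.2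
  have hL : torsion a (LinearMap.range L) = ⊤ := by
    rw [eq_top_iff]
    rintro ⟨⟨y, k, hk⟩, hy⟩ -
    exact ⟨k, fun r hr => Subtype.ext (Subtype.ext (hk r hr))⟩
  obtain ⟨k, hk⟩ := exists_pow_smul_eq_zero a _ hL
  rw [Submodule.mem_bot, Submodule.mkQ_apply, Submodule.Quotient.mk_eq_zero]
  refine ⟨k + n, fun r hr => ?_⟩
  rw [pow_add] at hr
  induction hr using Submodule.mul_induction_on' with
  | mem_mul_mem s hs t ht =>
    have := congrArg (fun z => ((z : torsion a M) : M)) (congrArg Subtype.val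
      (hk s hs ⟨L ⟨t, ht⟩, LinearMap.mem_range_self ..⟩))
    rw [mul_smul]
    exact this
  | add s _ t _ h1 h2 => rw [add_smul, h1, h2, add_zero]

variable {a M} in
lemma exists_mem_isSMulRegular [Module.Finite R M] (h : torsion a M = ⊥) :
    ∃ x ∈ a, IsSMulRegular M x := by
  by_contra! hc
  have hsub : (a : Set R) ⊆ ⋃ p ∈ associatedPrimes R M, p := by
    rw [biUnion_associatedPrimes_eq_compl_regular]
    exact hc
  obtain ⟨p, hp, hap⟩ := (a.subset_union_prime_finite (associatedPrimes.finite R M)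
    (f := id) 0 0 fun _ h _ _ => h.1).1 hsub
  obtain ⟨hp1, y, hy⟩ := isAssociatedPrime_iff.1 hp
  have hy0 : y ∈ torsion a M := ⟨1, fun r hr => by
    rw [pow_one] at hr
    have : r ∈ p := hap hr
    rw [hy] at this
    simpa using this⟩
  rw [h, Submodule.mem_bot] at hy0
  subst hy0
  exact hp1.ne_top (by rw [hy]; simp)

omit [IsNoetherianRing R] in
lemma exact_lsmul_mkQ (x : R) :
    Function.Exact (LinearMap.lsmul R M x) (x • (⊤ : Submodule R M)).mkQ := by
  rw [LinearMap.exact_iff, Submodule.ker_mkQ]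
  exact (LinearMap.range_eq_map _).symm

lemma lt_of_add_one_le {x y : WithBot ℕ∞} {i : ℕ} (h : x + 1 ≤ y) (hy : y < (i + 1 : ℕ)) :
    x < (i : ℕ) := by
  have := h.trans_lt hy
  induction x with
  | bot => exact WithBot.bot_lt_coe _
  | coe x =>
    have h2 : x + 1 < (i : ℕ∞) + 1 := by exact_mod_cast this
    exact_mod_cast lt_of_add_lt_add_right h2

namespace LC

/-- Reduction of statements about higher local cohomology to torsion-free modules. -/
lemma subsingleton_of_subsingleton_quotient (i : ℕ)
    (h : Subsingleton (LC a (i + 1) (M ⧸ torsion a M))) : Subsingleton (LC a (i + 1) M) :=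
  subsingleton_mid (LinearMap.exact_subtype_mkQ (torsion a M))
    (Submodule.injective_subtype _) (Submodule.mkQ_surjective _)
    (subsingleton_of_torsion_eq_top a i _ (torsion_torsion a M)) h

omit [IsNoetherianRing R] in
variable {a M} in
lemma subsingleton_of_smul_injective {i : ℕ} {x : R} (hx : x ∈ a)
    (h : Function.Injective fun u : LC a i M => x • u) : Subsingleton (LC a i M) := by
  refine subsingleton_of_forall_eq 0 fun u => ?_
  obtain ⟨n, hn⟩ := u.exists_pow_smul_eq_zero
  replace hn := hn _ (Ideal.pow_mem_pow hx n)
  induction n with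
  | zero => simpa using hn
  | succ n ih =>
    apply ih
    apply h
    simpa [pow_succ', mul_smul] using hn

/-- Grothendieck's vanishing theorem. -/
theorem subsingleton_of_supportDim_lt (i : ℕ) [Module.Finite R M]
    (h : Module.supportDim R M < (i : ℕ)) : Subsingleton (LC a i M) := by
  induction i generalizing M with
  | zero =>
    have : Module.supportDim R M = ⊥ := by
      by_contra hb
      obtain ⟨y, hy⟩ := WithBot.ne_bot_iff_exists.1 hb
      rw [← hy] at h
      exact absurd (WithBot.coe_lt_coe.1 h) (by simp)
    have := (Module.supportDim_eq_bot_iff_subsingleton R M).1 this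
    infer_instance
  | succ i ih =>
    suffices H : ∀ (N : Type) [AddCommGroup N] [Module R N] [Module.Finite R N],
        torsion a N = ⊥ → Module.supportDim R N < (i + 1 : ℕ) → Subsingleton (LC a (i + 1) N) from
      subsingleton_of_subsingleton_quotient _ _ _ (H _ (torsion_quotient_torsion a M)
        ((Module.supportDim_le_of_surjective _ (Submodule.mkQ_surjective _)).trans_lt h))
    intro N _ _ _ hN hdim
    obtain ⟨x, hxa, hx⟩ := exists_mem_isSMulRegular hN
    have h1 : Module.supportDim R (QuotSMulTop x N) < (i : ℕ) :=
      lt_of_add_one_le (Module.supportDim_quotSMulTop_succ_le_of_notMem_minimalPrimes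
        fun _ hp => hx.notMem_of_mem_minimalPrimes hp) hdim
    refine subsingleton_of_smul_injective hxa fun u v huv => ?_
    exact map_injective (exact_lsmul_mkQ N x) hx (Submodule.mkQ_surjective _) (ih _ h1)
      ((map_lsmul x u).trans (huv.trans (map_lsmul x v).symm))

end LC

end Vanishing

section Melkersson

variable {R : Type} [CommRing R] {H : Type} [AddCommGroup H] [Module R H]

lemma antitone_stabilizes (K : Submodule R H) [IsArtinian R K] (f : ℕ → Submodule R H)
    (hf : Antitone f) (hK : ∀ n, f n ≤ K) : ∃ n, ∀ m, n ≤ m → f m = f n := by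
  obtain ⟨n, hn⟩ := IsArtinian.monotone_stabilizes (R := R) (M := K)
    ⟨fun n => OrderDual.toDual (Submodule.comap K.subtype (f n)),
      fun m n h => Submodule.comap_mono (hf h)⟩
  refine ⟨n, fun m hm => ?_⟩
  have h1 : Submodule.comap K.subtype (f n) = Submodule.comap K.subtype (f m) := hn m hm
  have h2 := congrArg (Submodule.map K.subtype) h1
  rw [Submodule.map_comap_subtype, Submodule.map_comap_subtype, inf_eq_right.2 (hK n),
    inf_eq_right.2 (hK m)] at h2
  exact h2.symm

/-- A module all of whose elements are killed by a power of `x` is Artinian as soon as the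
submodule of elements killed by `x` is. -/
theorem isArtinian_of_isArtinian_ker (x : R) (hx : ∀ y : H, ∃ n : ℕ, x ^ n • y = 0)
    (hK : IsArtinian R (LinearMap.ker (LinearMap.lsmul R H x))) : IsArtinian R H := by
  rw [← monotone_stabilizes_iff_artinian]
  intro F
  let N : ℕ → Submodule R H := fun j => OrderDual.ofDual (F j)
  have hN : Antitone N := fun i j h => F.monotone h
  let A : ℕ → ℕ → Submodule R H := fun n j =>
    Submodule.map (LinearMap.lsmul R H (x ^ n)) (N j ⊓ LinearMap.ker (LinearMap.lsmul R H (x ^ (n + 1))))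
  have hAK : ∀ n j, A n j ≤ LinearMap.ker (LinearMap.lsmul R H x) := by
    rintro n j _ ⟨y, ⟨-, hy⟩, rfl⟩
    have hy : x ^ (n + 1) • y = 0 := hy
    rw [LinearMap.mem_ker, LinearMap.lsmul_apply, LinearMap.lsmul_apply, ← mul_smul,
      ← pow_succ', hy]
  have hAj : ∀ n, Antitone (A n) := fun n i j h =>
    Submodule.map_mono (inf_le_inf_right _ (hN h))
  have hAn : ∀ j, Antitone fun n => A n j := fun j => antitone_nat_of_succ_le fun n => by
    rintro _ ⟨y, ⟨hy1, hy⟩, rfl⟩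
    have hy : x ^ (n + 1 + 1) • y = 0 := hy
    refine ⟨x • y, ⟨(N j).smul_mem _ hy1, ?_⟩, ?_⟩
    · change x ^ (n + 1) • x • y = 0
      rw [← mul_smul, ← pow_succ, hy]
    · rw [LinearMap.lsmul_apply, LinearMap.lsmul_apply, ← mul_smul, ← pow_succ]
  obtain ⟨k₀, hk₀⟩ := antitone_stabilizes (LinearMap.ker (LinearMap.lsmul R H x))
    (fun k => A k k) (fun i j h => (hAj j h).trans (hAn i h)) (fun k => hAK k k)
  choose l hl using fun n => antitone_stabilizes (LinearMap.ker (LinearMap.lsmul R H x))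
    (A n) (hAj n) (hAK n)
  let j₀ := k₀ ⊔ (Finset.range k₀).sup l
  have hj₀ : ∀ n j, j₀ ≤ j → A n j₀ ≤ A n j := by
    intro n j hj
    by_cases hn : n < k₀
    · have h1 : l n ≤ j₀ := (Finset.le_sup (Finset.mem_range.2 hn)).trans le_sup_right
      rw [hl n j₀ h1, hl n j (h1.trans hj)]
    · have hk : k₀ ≤ j₀ := le_sup_left
      push Not at hn
      calc A n j₀ ≤ A k₀ k₀ := (hAj n hk).trans (hAn k₀ hn)
        _ = A (n ⊔ j) (n ⊔ j) := (hk₀ _ (hn.trans le_sup_left)).symm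
        _ ≤ A n j := (hAj _ le_sup_right).trans (hAn j le_sup_left)
  refine ⟨j₀, fun j hj => le_antisymm (F.monotone hj) ?_⟩
  have key : ∀ n : ℕ, ∀ y ∈ N j₀, x ^ n • y = 0 → y ∈ N j := by
    intro n
    induction n with
    | zero =>
      intro y _ h
      rw [pow_zero, one_smul] at h
      exact h ▸ zero_mem _
    | succ n ih =>
      intro y hy h
      obtain ⟨z, ⟨hz, -⟩, hzy⟩ := hj₀ n j hj ⟨y, ⟨hy, h⟩, rfl⟩
      have hzy : x ^ n • z = x ^ n • y := hzy
      have := ih (y - z) (sub_mem hy (hN hj hz)) (by rw [smul_sub, hzy, sub_self])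
      simpa using add_mem this hz
  intro y hy
  obtain ⟨n, hn⟩ := hx y
  exact key n y hy hn

end Melkersson

section Artinian

open Pointwise

variable {R : Type} [CommRing R] {a : Ideal R}

lemma LC.exists_range_eq_ker_lsmul {N : Type} [AddCommGroup N] [Module R N] {x : R}
    (hx : IsSMulRegular N x) (a : Ideal R) (i : ℕ) :
    ∃ δ : LC a i (QuotSMulTop x N) →ₗ[R] LC a (i + 1) N,
      LinearMap.range δ = LinearMap.ker (LinearMap.lsmul R (LC a (i + 1) N) x) := by
  obtain ⟨δ, -, h⟩ := exists_connecting _ _ (exact_lsmul_mkQ N x) hx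
    (Submodule.mkQ_surjective _) a i
  refine ⟨δ, ?_⟩
  ext u
  rw [LinearMap.mem_ker, LinearMap.lsmul_apply, ← map_lsmul]
  exact (h u).symm

lemma LC.isArtinian_succ {N : Type} [AddCommGroup N] [Module R N] {x : R} {i : ℕ} (hxa : x ∈ a)
    (hx : IsSMulRegular N x) (h : IsArtinian R (LC a i (QuotSMulTop x N))) :
    IsArtinian R (LC a (i + 1) N) := by
  apply isArtinian_of_isArtinian_ker x
  · intro y
    obtain ⟨n, hn⟩ := y.exists_pow_smul_eq_zero
    exact ⟨n, hn _ (Ideal.pow_mem_pow hxa n)⟩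
  · obtain ⟨δ, hδ⟩ := exists_range_eq_ker_lsmul hx a i
    rw [← hδ]
    infer_instance

variable [IsNoetherianRing R]

/-- Higher local cohomology does not see the torsion submodule. -/
noncomputable def LC.quotientTorsionEquiv (a : Ideal R) (i : ℕ)
    (M : Type) [AddCommGroup M] [Module R M] :
    LC a (i + 1) M ≃ₗ[R] LC a (i + 1) (M ⧸ torsion a M) :=
  LinearEquiv.ofBijective (map a (i + 1) (torsion a M).mkQ) <| by
    have hT := fun i => subsingleton_of_torsion_eq_top a i _ (torsion_torsion a M)
    have hex := LinearMap.exact_subtype_mkQ (torsion a M)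
    refine ⟨?_, map_surjective hex (Submodule.injective_subtype _) (Submodule.mkQ_surjective _)
      (hT _)⟩
    rw [injective_iff_map_eq_zero]
    intro x hx
    obtain ⟨y, rfl⟩ := (map_exact _ _ hex (Submodule.injective_subtype _)
      (Submodule.mkQ_surjective _) x).1 hx
    rw [(hT i).elim y 0, _root_.map_zero]

/-- A finite module over a local ring killed by a power of the maximal ideal is Artinian. -/
lemma isArtinian_of_pow_le_annihilator [IsLocalRing R] (M : Type) [AddCommGroup M] [Module R M]
    [Module.Finite R M] (s : ℕ)
    (h : IsLocalRing.maximalIdeal R ^ s ≤ Module.annihilator R M) : IsArtinian R M := by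
  have : IsArtinianRing (R ⧸ IsLocalRing.maximalIdeal R ^ (s + 1)) := by
    set I := IsLocalRing.maximalIdeal R ^ (s + 1)
    have hI : I ≠ ⊤ := fun h => (IsLocalRing.maximalIdeal.isMaximal R).ne_top
      (top_le_iff.1 (h ▸ Ideal.pow_le_self (Nat.succ_ne_zero s)))
    have : Nontrivial (R ⧸ I) := Ideal.Quotient.nontrivial_iff.mpr hI
    have := IsLocalRing.of_surjective' (Ideal.Quotient.mk I) Ideal.Quotient.mk_surjective
    have := IsLocalHom.of_surjective (Ideal.Quotient.mk I) Ideal.Quotient.mk_surjective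
    have : (IsLocalRing.maximalIdeal R).map (Ideal.Quotient.mk I) =
        IsLocalRing.maximalIdeal (R ⧸ I) := by
      ext x
      obtain ⟨x, rfl⟩ := Ideal.Quotient.mk_surjective x
      simp [sup_eq_left.mpr (IsLocalRing.le_maximalIdeal hI)]
    refine (isArtinianRing_iff_isNilpotent_maximalIdeal _).2 ⟨s + 1, ?_⟩
    rw [← this, ← Ideal.map_pow, Ideal.zero_eq_bot, Ideal.map_eq_bot_iff_le_ker, Ideal.mk_ker]
  have hM : Module.IsTorsionBySet R M (IsLocalRing.maximalIdeal R ^ (s + 1) : Ideal R) :=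
    fun x r => Module.mem_annihilator.1 (h (Ideal.pow_le_pow_right (Nat.le_succ s) r.2)) x
  let := hM.module
  have := hM.isScalarTower (S := R)
  have : Module.Finite (R ⧸ IsLocalRing.maximalIdeal R ^ (s + 1)) M :=
    Module.Finite.of_restrictScalars_finite R _ M
  exact isArtinian_of_surjective_algebraMap (R := R ⧸ IsLocalRing.maximalIdeal R ^ (s + 1))
    Ideal.Quotient.mk_surjective

/-- Local cohomology of a module whose support meets `V(a)` in the closed point is Artinian. -/
theorem LC.isArtinian_of_pow_le [IsLocalRing R] (a : Ideal R) (i : ℕ) (M : Type)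
    [AddCommGroup M] [Module R M] [Module.Finite R M] (s : ℕ)
    (h : IsLocalRing.maximalIdeal R ^ s ≤ a ⊔ Module.annihilator R M) :
    IsArtinian R (LC a i M) := by
  induction i generalizing M with
  | zero =>
    obtain ⟨n, hn⟩ := LocCoh.exists_pow_smul_eq_zero a _ (torsion_torsion a M)
    have : IsArtinian R (torsion a M) := by
      refine isArtinian_of_pow_le_annihilator _ (s * (n + 1)) ?_
      rw [pow_mul]
      refine (Ideal.pow_right_mono h _).trans (Ideal.sup_pow_add_le_pow_sup_pow.trans ?_)
      rw [pow_one, sup_le_iff]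
      exact ⟨fun r hr => Module.mem_annihilator.2 (hn r hr),
        LinearMap.annihilator_le_of_injective _ (Submodule.injective_subtype _)⟩
    exact isArtinian_of_injective ((zeroEmb a M).codRestrict (torsion a M)
      fun x => (exists_zeroEmb_eq_iff _).1 ⟨x, rfl⟩)
      fun x y h => zeroEmb_injective (congrArg Subtype.val h)
  | succ i ih =>
    suffices H : ∀ (N : Type) [AddCommGroup N] [Module R N] [Module.Finite R N],
        torsion a N = ⊥ → Module.annihilator R M ≤ Module.annihilator R N →
          IsArtinian R (LC a (i + 1) N) from
      (quotientTorsionEquiv a i M).isArtinian_iff.2 (H _ (torsion_quotient_torsion a M)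
        ((torsion a M).mkQ.annihilator_le_of_surjective (Submodule.mkQ_surjective _)))
    intro N _ _ _ hN hann
    obtain ⟨x, hxa, hx⟩ := exists_mem_isSMulRegular hN
    refine isArtinian_succ hxa hx (ih _ (h.trans (sup_le_sup_left (hann.trans ?_) _)))
    exact (Submodule.mkQ _).annihilator_le_of_surjective (Submodule.mkQ_surjective _)

end Artinian

section Socle

variable {R : Type} [CommRing R]

/-- The submodules containing `e` in which every nonzero element has `e` as a multiple. -/
def essentialOver {J : Type} [AddCommGroup J] [Module R J] (e : J) : Set (Submodule R J) :=
  {E | e ∈ E ∧ ∀ x ∈ E, x ≠ 0 → ∃ r : R, r • x = e}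

/-- Every element of an injective module with prescribed annihilator property generates an
essential submodule of an injective submodule. -/
lemma exists_injective_essentialOver {J : Type} [AddCommGroup J] [Module R J]
    [Module.Injective R J] (e : J) (he : e ≠ 0)
    (hke : ∀ r : R, r • e ≠ 0 → ∃ s : R, s • r • e = e) :
    ∃ E ∈ essentialOver (R := R) e, Module.Injective R E := by
  obtain ⟨E, -, hE⟩ := zorn_le_nonempty₀ (essentialOver (R := R) e) (by
    intro c hc hch y hy
    refine ⟨sSup c, ⟨le_sSup hy (hc hy).1, fun x hx hx0 => ?_⟩, fun z hz => le_sSup hz⟩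
    obtain ⟨z, hz, hxz⟩ := (Submodule.mem_sSup_of_directed ⟨y, hy⟩ hch.directedOn).1 hx
    exact (hc hz).2 x hxz hx0) (R ∙ e) ⟨Submodule.mem_span_singleton_self e, by
      intro x hx hx0
      obtain ⟨r, rfl⟩ := Submodule.mem_span_singleton.1 hx
      exact hke r hx0⟩
  obtain ⟨K, -, hK⟩ := zorn_le_nonempty₀ {K : Submodule R J | e ∉ K} (by
    intro c hc hch y hy
    refine ⟨sSup c, fun h => ?_, fun z hz => le_sSup hz⟩
    obtain ⟨z, hz, hxz⟩ := (Submodule.mem_sSup_of_directed ⟨y, hy⟩ hch.directedOn).1 h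
    exact hc hz hxz) ⊥ (by simpa using he)
  refine ⟨E, hE.1, ?_⟩
  have hinj : Function.Injective (K.mkQ ∘ₗ E.subtype) := by
    rw [← LinearMap.ker_eq_bot, LinearMap.ker_eq_bot']
    intro x hx
    by_contra hx0
    obtain ⟨r, hr⟩ := hE.1.2 x x.2 fun h => hx0 (Subtype.ext h)
    exact hK.1 (hr ▸ K.smul_mem r ((Submodule.Quotient.mk_eq_zero K).1 hx))
  obtain ⟨φ, hφ⟩ := Module.Injective.extension_property R J _ _ _ hinj E.subtype
  have hφE : ∀ x ∈ E, φ (K.mkQ x) = x := fun x hx => LinearMap.congr_fun hφ ⟨x, hx⟩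
  have hle : E ≤ LinearMap.range φ := fun x hx => ⟨_, hφE x hx⟩
  have hmem : LinearMap.range φ ∈ essentialOver (R := R) e := by
    refine ⟨hle hE.1.1, ?_⟩
    rintro _ ⟨z, rfl⟩ hz
    obtain ⟨z, rfl⟩ := K.mkQ_surjective z
    have hzK : z ∉ K := fun h => hz (by
      rw [Submodule.mkQ_apply, (Submodule.Quotient.mk_eq_zero K).2 h, map_zero])
    have hlt : e ∈ K ⊔ R ∙ z := by
      by_contra h
      exact hzK (hK.2 h le_sup_left (le_sup_right (a := K) (Submodule.mem_span_singleton_self z)))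
    obtain ⟨k, hk, w, hw, hkw⟩ := Submodule.mem_sup.1 hlt
    obtain ⟨r, rfl⟩ := Submodule.mem_span_singleton.1 hw
    refine ⟨r, ?_⟩
    rw [← hφE e hE.1.1, ← hkw, map_add, map_smul, map_add, map_smul, Submodule.mkQ_apply K k,
      (Submodule.Quotient.mk_eq_zero K).2 hk, map_zero, zero_add]
  have hrange : LinearMap.range φ ≤ E := hE.2 hmem hle
  constructor
  intro X Y _ _ _ _ f hf g
  obtain ⟨h, hh⟩ := Module.Injective.out (Q := J) f hf (E.subtype ∘ₗ g)
  refine ⟨(φ ∘ₗ K.mkQ).codRestrict E (fun x => hrange ⟨_, rfl⟩) ∘ₗ h, fun x => Subtype.ext ?_⟩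
  change φ (K.mkQ (h (f x))) = g x
  rw [hh]
  exact hφE _ (g x).2

/-- A local ring has an injective module with one-dimensional socle. -/
lemma exists_injective_socle (R : Type) [CommRing R] [IsLocalRing R] :
    ∃ (E : Type) (_ : AddCommGroup E) (_ : Module R E) (e : E), Module.Injective R E ∧ e ≠ 0 ∧
      (∀ r ∈ IsLocalRing.maximalIdeal R, r • e = 0) ∧
      ∀ x : E, (∀ r ∈ IsLocalRing.maximalIdeal R, r • x = 0) → ∃ c : R, x = c • e := by
  obtain ⟨J, _, _, f, _, hf⟩ :=
    exists_injective_embedding R (R ⧸ IsLocalRing.maximalIdeal R)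
  have hm : ∀ r ∈ IsLocalRing.maximalIdeal R, r • f 1 = 0 := fun r hr => by
    rw [← map_smul, Algebra.smul_def, mul_one, Ideal.Quotient.algebraMap_eq,
      Ideal.Quotient.eq_zero_iff_mem.2 hr, map_zero]
  have h1 : f 1 ≠ 0 := fun h => one_ne_zero ((map_eq_zero_iff f hf).1 h)
  have hu : ∀ (M : Type) [AddCommGroup M] [Module R M] (r : R) (x y : M), y ≠ 0 →
      (∀ r ∈ IsLocalRing.maximalIdeal R, r • x = 0) → r • x = y → ∃ s : R, x = s • y := by
    intro M _ _ r x y hy hx hxy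
    have : IsUnit r := by
      by_contra h
      exact hy (hxy ▸ hx r ((IsLocalRing.mem_maximalIdeal r).2 h))
    obtain ⟨s, hs⟩ := this.exists_left_inv
    exact ⟨s, by rw [← hxy, ← mul_smul, hs, one_smul]⟩
  obtain ⟨E, hE, hEi⟩ := exists_injective_essentialOver (f 1) h1 (R := R) fun r hr =>
    (hu J r _ _ hr hm rfl).imp fun s hs => hs.symm
  refine ⟨E, inferInstance, inferInstance, ⟨f 1, hE.1⟩, hEi, fun h => h1 (congrArg Subtype.val h),
    fun r hr => Subtype.ext (hm r hr), fun x hx => ?_⟩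
  by_cases hx0 : x = 0
  · exact ⟨0, by rw [hx0, zero_smul]⟩
  obtain ⟨r, hr⟩ := hE.2 x x.2 fun h => hx0 (Subtype.ext h)
  exact hu E r x ⟨f 1, hE.1⟩ (fun h => h1 (congrArg Subtype.val h)) hx (Subtype.ext hr)

end Socle

section CompleteNakayama

variable {R : Type} [CommRing R]

lemma isPrecomplete_pi (I : Ideal R) [IsPrecomplete I R] (ι : Type) [Finite ι] :
    IsPrecomplete I (ι → R) := by
  classical
  have := Fintype.ofFinite ι
  have hmem : ∀ (n : ℕ) (x : ι → R),
      x ∈ (I ^ n • ⊤ : Submodule R (ι → R)) ↔ ∀ i, x i ∈ I ^ n := by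
    refine fun n x => ⟨fun hx i => ?_, fun hx => ?_⟩
    · refine Submodule.smul_induction_on (p := fun x : ι → R => x i ∈ I ^ n) hx ?_ ?_
      · intro r hr x _
        exact Ideal.mul_mem_right _ _ hr
      · exact fun x y hx hy => add_mem hx hy
    · rw [pi_eq_sum_univ' x]
      exact Submodule.sum_mem _ fun i _ => Submodule.smul_mem_smul (hx i) trivial
  refine ⟨fun f hf => ?_⟩
  have : ∀ i, ∃ L : R, ∀ n, f n i ≡ L [SMOD (I ^ n • ⊤ : Submodule R R)] := fun i =>
    IsPrecomplete.prec' (fun n => f n i) fun {m n} hmn => by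
      rw [SModEq.sub_mem, smul_eq_mul, Ideal.mul_top]
      exact (hmem _ _).1 (SModEq.sub_mem.1 (hf hmn)) i
  choose L hL using this
  refine ⟨L, fun n => SModEq.sub_mem.2 ((hmem _ _).2 fun i => ?_)⟩
  have := SModEq.sub_mem.1 (hL i n)
  rwa [smul_eq_mul, Ideal.mul_top] at this

/-- Nakayama's lemma over an adically complete ring. -/
theorem finite_of_finite_quotient (I : Ideal R) [IsPrecomplete I R] (D : Type) [AddCommGroup D]
    [Module R D] [IsHausdorff I D] [Module.Finite R (D ⧸ (I • ⊤ : Submodule R D))] :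
    Module.Finite R D := by
  obtain ⟨n, f, hf⟩ := Module.Finite.exists_fin' R (D ⧸ (I • ⊤ : Submodule R D))
  obtain ⟨g, hg⟩ := Module.projective_lifting_property (Submodule.mkQ (I • ⊤ : Submodule R D)) f
    (Submodule.mkQ_surjective _)
  have := isPrecomplete_pi I (Fin n)
  exact Module.Finite.of_surjective g (surjective_of_mkQ_comp_surjective (I := I) (hg ▸ hf))

end CompleteNakayama

section Duality

variable {R : Type} [CommRing R] {H E : Type} [AddCommGroup H] [Module R H]
  [AddCommGroup E] [Module R E]

/-- Factorization through a map into an injective module. -/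
lemma exists_extension_of_ker_le [Module.Injective R E] {A B : Type} [AddCommGroup A] [Module R A]
    [AddCommGroup B] [Module R B] (g : A →ₗ[R] B) (f : A →ₗ[R] E)
    (h : LinearMap.ker g ≤ LinearMap.ker f) : ∃ F : B →ₗ[R] E, F ∘ₗ g = f := by
  obtain ⟨F, hF⟩ := Module.Injective.extension_property R E _ _
    ((LinearMap.ker g).liftQ g le_rfl)
    (LinearMap.ker_eq_bot.1 (Submodule.ker_liftQ_eq_bot _ _ _ le_rfl))
    ((LinearMap.ker g).liftQ f h)
  refine ⟨F, LinearMap.ext fun x => ?_⟩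
  simpa using LinearMap.congr_fun hF ((LinearMap.ker g).mkQ x)

/-- A map to an injective module which vanishes on the elements killed by a finitely generated
ideal is a combination of maps with coefficients in the ideal. -/
lemma mem_smul_top_of_vanish [Module.Injective R E] (I : Ideal R) (hI : I.FG) (f : H →ₗ[R] E)
    (hf : ∀ h : H, (∀ r ∈ I, r • h = 0) → f h = 0) :
    f ∈ (I • ⊤ : Submodule R (H →ₗ[R] E)) := by
  classical
  obtain ⟨n, x, rfl⟩ := Submodule.fg_iff_exists_fin_generating_family.1 hI
  obtain ⟨F, hF⟩ := exists_extension_of_ker_le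
    (LinearMap.pi fun i => LinearMap.lsmul R H (x i) : H →ₗ[R] (Fin n → H)) f (by
      intro h hh
      refine hf h fun r hr => ?_
      have : Submodule.span R (Set.range x) ≤ (R ∙ h).annihilator := by
        rw [Submodule.span_le]
        rintro _ ⟨i, rfl⟩
        rw [SetLike.mem_coe, Submodule.mem_annihilator_span_singleton]
        exact congrFun hh i
      exact (Submodule.mem_annihilator_span_singleton _ _).1 (this hr))
  have : f = ∑ i, x i • (F ∘ₗ LinearMap.single R (fun _ => H) i) := by
    ext h
    rw [← hF]
    simp only [LinearMap.coe_comp, Function.comp_apply, LinearMap.sum_apply, LinearMap.smul_apply,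
      LinearMap.coe_single]
    simp only [← map_smul, ← map_sum, ← Pi.single_smul]
    congr 1
    ext i
    simp [Finset.sum_apply, Pi.single_apply]
  rw [this]
  exact Submodule.sum_mem _ fun i _ => Submodule.smul_mem_smul
    (Submodule.subset_span ⟨i, rfl⟩) trivial

lemma vanish_of_mem_smul_top (I : Ideal R) (f : H →ₗ[R] E)
    (hf : f ∈ (I • ⊤ : Submodule R (H →ₗ[R] E))) (h : H) (hh : ∀ r ∈ I, r • h = 0) : f h = 0 := by
  refine Submodule.smul_induction_on (p := fun f : H →ₗ[R] E => f h = 0) hf ?_ ?_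
  · intro r hr g _
    rw [LinearMap.smul_apply, ← map_smul, hh r hr, map_zero]
  · intro f g hf hg
    rw [LinearMap.add_apply, hf, hg, add_zero]

/-- The elements of an Artinian module killed by the maximal ideal form a finite module. -/
lemma finite_of_isArtinian_of_maximalIdeal [IsLocalRing R] [IsArtinian R H]
    (h : ∀ r ∈ IsLocalRing.maximalIdeal R, ∀ x : H, r • x = 0) : Module.Finite R H := by
  have hM : Module.IsTorsionBySet R H (IsLocalRing.maximalIdeal R : Set R) :=
    fun x r => h r r.2 x
  let := hM.module
  have := hM.isScalarTower (S := R)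
  let := Ideal.Quotient.field (IsLocalRing.maximalIdeal R)
  have : IsArtinian (R ⧸ IsLocalRing.maximalIdeal R) H := isArtinian_of_tower R inferInstance
  have := IsSemiprimaryRing.isNoetherian_iff_isArtinian (R := R ⧸ IsLocalRing.maximalIdeal R)
    (M := H)
  have := this.2 inferInstance
  exact Module.Finite.trans (R ⧸ IsLocalRing.maximalIdeal R) H

/-- Let `H` be an Artinian module over a complete Noetherian local ring. If the elements
killed by `a` are killed by a power of the maximal ideal, then `a + Ann H` contains a power of the
maximal ideal. -/
theorem exists_pow_le_sup_annihilator [IsLocalRing R] [IsNoetherianRing R]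
    [IsPrecomplete (IsLocalRing.maximalIdeal R) R] [IsArtinian R H]
    (htors : ∀ x : H, ∃ n : ℕ, ∀ r ∈ IsLocalRing.maximalIdeal R ^ n, r • x = 0)
    (a : Ideal R) (s : ℕ)
    (hs : ∀ h : H, (∀ r ∈ a, r • h = 0) → ∀ r ∈ IsLocalRing.maximalIdeal R ^ s, r • h = 0) :
    ∃ N : ℕ, IsLocalRing.maximalIdeal R ^ N ≤ a ⊔ Module.annihilator R H := by
  classical
  obtain ⟨E, _, _, e, _, he, hme, hsoc⟩ := exists_injective_socle R
  let m := IsLocalRing.maximalIdeal R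
  have hfg : ∀ I : Ideal R, I.FG := isNoetherian_def.1 inferInstance
  have : IsHausdorff m (H →ₗ[R] E) := ⟨fun f hf => LinearMap.ext fun h => by
    obtain ⟨n, hn⟩ := htors h
    exact vanish_of_mem_smul_top _ f (SModEq.zero.1 (hf n)) h hn⟩
  have : Module.Finite R ((H →ₗ[R] E) ⧸ (m • ⊤ : Submodule R (H →ₗ[R] E))) := by
    let S : Submodule R H := Submodule.torsionBySet R H m
    have hS : ∀ x, x ∈ S ↔ ∀ r ∈ m, r • x = 0 := fun x => by
      rw [Submodule.mem_torsionBySet_iff]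
      exact ⟨fun h r hr => h ⟨r, hr⟩, fun h r => h r r.2⟩
    have : Module.Finite R S := finite_of_isArtinian_of_maximalIdeal fun r hr x =>
      Subtype.ext ((hS _).1 x.2 r hr)
    obtain ⟨t, y, hy⟩ := Submodule.fg_iff_exists_fin_generating_family.1
      ((Submodule.fg_top S).1 this.fg_top)
    have hyS : ∀ i, y i ∈ S := fun i => hy ▸ Submodule.subset_span ⟨i, rfl⟩
    let Φ : (H →ₗ[R] E) →ₗ[R] (Fin t → (R ∙ e)) := LinearMap.pi fun i =>
      (LinearMap.applyₗ' R (y i) : (H →ₗ[R] E) →ₗ[R] E).codRestrict (R ∙ e) fun f => by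
        obtain ⟨c, hc⟩ := hsoc (f (y i)) fun r hr => by
          rw [← map_smul, (hS _).1 (hyS i) r hr, map_zero]
        exact Submodule.mem_span_singleton.2 ⟨c, hc.symm⟩
    have hΦ : LinearMap.ker Φ ≤ m • ⊤ := by
      intro f hf
      refine mem_smul_top_of_vanish m (hfg m) f fun h hh => ?_
      have : S ≤ LinearMap.ker f := by
        rw [← hy, Submodule.span_le]
        rintro _ ⟨i, rfl⟩
        exact congrArg Subtype.val (congrFun hf i)
      exact this ((hS h).2 hh)
    have : Module.Finite R ((H →ₗ[R] E) ⧸ LinearMap.ker Φ) :=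
      Module.Finite.equiv Φ.quotKerEquivRange.symm
    exact Module.Finite.of_surjective (Submodule.factor hΦ) (Submodule.factor_surjective hΦ)
  have : Module.Finite R (H →ₗ[R] E) := finite_of_finite_quotient m _
  have hann : Module.annihilator R (H →ₗ[R] E) ≤ Module.annihilator R H := by
    intro r hr
    refine Module.mem_annihilator.2 fun x => ?_
    by_contra hx
    obtain ⟨F, hF⟩ := exists_extension_of_ker_le (LinearMap.toSpanSingleton R H (r • x))
      (LinearMap.toSpanSingleton R E e) (by
        intro c hc
        refine hme c ((IsLocalRing.mem_maximalIdeal c).2 fun hu => hx ?_)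
        exact (hu.smul_eq_zero).1 hc)
    refine he ?_
    have h1 := LinearMap.congr_fun hF 1
    simp only [LinearMap.comp_apply, LinearMap.toSpanSingleton_apply, one_smul] at h1
    rw [← h1, map_smul, ← LinearMap.smul_apply, Module.mem_annihilator.1 hr, LinearMap.zero_apply]
  have hrad : m ^ s ≤ (a ⊔ Module.annihilator R H).radical := by
    intro u hu
    obtain ⟨p, hp, -, hpc, hp0⟩ :=
      LinearMap.exists_monic_and_natDegree_eq_and_coeff_mem_pow_and_aeval_eq_zero R
        (LinearMap.lsmul R (H →ₗ[R] E) u) a (by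
          rintro _ ⟨f, rfl⟩
          refine mem_smul_top_of_vanish a (hfg a) _ fun h hh => ?_
          rw [LinearMap.lsmul_apply, LinearMap.smul_apply, ← map_smul, hs h hh u hu, map_zero])
    refine ⟨p.natDegree, ?_⟩
    have h1 : p.eval u ∈ Module.annihilator R (H →ₗ[R] E) := by
      refine Module.mem_annihilator.2 fun f => ?_
      have h2 := LinearMap.congr_fun hp0 f
      have h3 : LinearMap.lsmul R (H →ₗ[R] E) u = algebraMap R (Module.End R (H →ₗ[R] E)) u := rfl
      rwa [h3, Polynomial.aeval_algebraMap_apply, Polynomial.coe_aeval_eq_eval] at h2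
    rw [Polynomial.eval_eq_sum_range, Finset.sum_range_succ, hp.coeff_natDegree, one_mul] at h1
    have h4 : ∑ i ∈ Finset.range p.natDegree, p.coeff i * u ^ i ∈ a := by
      refine Ideal.sum_mem _ fun i hi => Ideal.mul_mem_right _ _ ?_
      exact Ideal.pow_le_self (Nat.sub_ne_zero_of_lt (Finset.mem_range.1 hi)) (hpc i)
    refine (Ideal.add_mem_iff_right _ (Ideal.mem_sup_left h4)).1 (Ideal.mem_sup_right (hann h1))
  obtain ⟨N, hN⟩ := Ideal.exists_pow_le_of_le_radical_of_fg hrad (hfg _)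
  exact ⟨s * N, by rwa [pow_mul]⟩

end Duality

section Lichtenbaum

variable {R : Type} [CommRing R]

lemma le_of_lt_add_one' {x : WithBot ℕ∞} {n : ℕ} (h : x < (n + 1 : ℕ)) : x ≤ n := by
  induction x with
  | bot => exact bot_le
  | coe x =>
    have h' : x < (n + 1 : ℕ) := by exact_mod_cast h
    have : x ≤ n := ENat.lt_add_one_iff (ENat.natCast_ne_top n) |>.1 (by exact_mod_cast h')
    exact_mod_cast this

lemma lt_add_one_of_le' {x : WithBot ℕ∞} {n : ℕ} (h : x ≤ n) : x < (n + 1 : ℕ) :=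
  h.trans_lt (by exact_mod_cast n.lt_succ_self)

/-- If `r` is regular on `N` and the cohomology of `N ⧸ r N` vanishes, then `r` acts surjectively
on the cohomology of `N`. -/
lemma LC.smul_surjective {N : Type} [AddCommGroup N] [Module R N] {r : R}
    (hr : IsSMulRegular N r) (a : Ideal R) (i : ℕ) (h : Subsingleton (LC a i (QuotSMulTop r N)))
    (y : LC a i N) : ∃ x : LC a i N, r • x = y := by
  obtain ⟨x, hx⟩ := (map_exact _ _ (exact_lsmul_mkQ N r) hr (Submodule.mkQ_surjective _) y).1
    (Subsingleton.elim _ _)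
  exact ⟨x, by rw [← hx, map_lsmul]⟩

lemma supportDim_quotSMulTop_lt {N : Type} [AddCommGroup N] [Module R N] [IsNoetherianRing R]
    [Module.Finite R N] {r : R} (hr : IsSMulRegular N r) {d : ℕ}
    (hd : Module.supportDim R N ≤ d) : Module.supportDim R (QuotSMulTop r N) < d :=
  lt_of_add_one_le (Module.supportDim_quotSMulTop_succ_le_of_notMem_minimalPrimes
    fun _ hp => hr.notMem_of_mem_minimalPrimes hp) (lt_add_one_of_le' hd)

lemma isSMulRegular_quotient_of_notMem {q : Ideal R} [q.IsPrime] {r : R} (hr : r ∉ q) :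
    IsSMulRegular (R ⧸ q) r := by
  rw [isSMulRegular_iff_right_eq_zero_of_smul]
  intro x hx
  rw [Algebra.smul_def, mul_eq_zero] at hx
  exact hx.resolve_left fun h => hr (Ideal.Quotient.eq_zero_iff_mem.1 h)

variable [IsLocalRing R]

/-- Elements of an Artinian module over a local ring are killed by powers of the maximal ideal. -/
lemma exists_maximalIdeal_pow_smul_eq_zero {H : Type} [AddCommGroup H] [Module R H]
    [IsArtinian R H] [IsNoetherianRing R] (x : H) :
    ∃ n : ℕ, ∀ r ∈ IsLocalRing.maximalIdeal R ^ n, r • x = 0 := by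
  obtain ⟨n, hn⟩ := IsArtinian.monotone_stabilizes (R := R) (M := H)
    ⟨fun n => OrderDual.toDual (IsLocalRing.maximalIdeal R ^ n • (R ∙ x)),
      fun m n h => Submodule.smul_mono_left (Ideal.pow_le_pow_right h)⟩
  have h1 : IsLocalRing.maximalIdeal R ^ n • (R ∙ x) =
    IsLocalRing.maximalIdeal R ^ (n + 1) • (R ∙ x) := hn (n + 1) n.le_succ
  have h2 : IsLocalRing.maximalIdeal R ^ n • (R ∙ x) = ⊥ := by
    refine Submodule.eq_bot_of_le_smul_of_le_jacobson_bot (IsLocalRing.maximalIdeal R) _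
      ?_ ?_ (IsLocalRing.maximalIdeal_le_jacobson _)
    · exact Submodule.FG.smul (isNoetherian_def.1 inferInstance _) (Submodule.fg_span_singleton x)
    · rw [← Submodule.mul_smul, ← pow_succ', ← h1]
  refine ⟨n, fun r hr => ?_⟩
  have := Submodule.smul_mem_smul hr (Submodule.mem_span_singleton_self (R := R) x)
  rwa [h2, Submodule.mem_bot] at this

/-- An ideal defining a zero-dimensional quotient contains a power of the maximal ideal. -/
lemma exists_pow_le_of_ringKrullDim_le_zero [IsNoetherianRing R] (I : Ideal R)
    (h : ringKrullDim (R ⧸ I) ≤ 0) : ∃ s : ℕ, IsLocalRing.maximalIdeal R ^ s ≤ I := by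
  refine Ideal.exists_pow_le_of_le_radical_of_fg ?_ (isNoetherian_def.1 inferInstance _)
  rw [Ideal.radical_eq_sInf]
  refine le_sInf ?_
  rintro p ⟨hIp, hp⟩
  by_contra hlt
  rw [ringKrullDim_quotient] at h
  have hpm := IsLocalRing.le_maximalIdeal hp.ne_top
  refine absurd h (not_le.2 ?_)
  rw [Order.krullDim_pos_iff]
  refine ⟨⟨⟨p, hp⟩, hIp⟩, ⟨⟨IsLocalRing.maximalIdeal R, inferInstance⟩, hIp.trans hpm⟩, ?_⟩
  exact lt_of_le_not_ge hpm hlt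

/-- Top local cohomology over a complete local ring is Artinian, and its annihilator together with
the ideal generates a zero-dimensional ideal. -/
theorem LC.isArtinian_and_exists_pow_le [IsNoetherianRing R]
    [IsPrecomplete (IsLocalRing.maximalIdeal R) R] (a : Ideal R) (d : ℕ) (M : Type)
    [AddCommGroup M] [Module R M] [Module.Finite R M]
    (hM : Module.supportDim R M < (d + 1 : ℕ)) :
    IsArtinian R (LC a d M) ∧
      ∃ s : ℕ, IsLocalRing.maximalIdeal R ^ s ≤ a ⊔ Module.annihilator R (LC a d M) := by
  induction d generalizing M with
  | zero =>
    obtain ⟨s, hs⟩ := exists_pow_le_of_ringKrullDim_le_zero (Module.annihilator R M) (by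
      rw [← Module.supportDim_eq_ringKrullDim_quotient_annihilator]
      exact le_of_lt_add_one' (n := 0) (by simpa using hM))
    have := isArtinian_of_pow_le_annihilator M s hs
    exact ⟨isArtinian_of_injective _ (zeroEmb_injective (a := a) (M := M)), s, hs.trans
      (le_sup_of_le_right (LinearMap.annihilator_le_of_injective _ zeroEmb_injective))⟩
  | succ d ih =>
    suffices H : ∀ (N : Type) [AddCommGroup N] [Module R N] [Module.Finite R N],
        torsion a N = ⊥ → Module.supportDim R N < (d + 1 + 1 : ℕ) →
          IsArtinian R (LC a (d + 1) N) ∧ ∃ s : ℕ,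
            IsLocalRing.maximalIdeal R ^ s ≤ a ⊔ Module.annihilator R (LC a (d + 1) N) by
      have := H _ (torsion_quotient_torsion a M)
        ((Module.supportDim_le_of_surjective _ (Submodule.mkQ_surjective _)).trans_lt hM)
      rwa [← (quotientTorsionEquiv a d M).isArtinian_iff,
        ← (quotientTorsionEquiv a d M).annihilator_eq] at this
    intro N _ _ _ hN hdim
    obtain ⟨x, hxa, hx⟩ := exists_mem_isSMulRegular hN
    obtain ⟨hart, s, hs⟩ := ih (QuotSMulTop x N) (lt_of_add_one_le
      (Module.supportDim_quotSMulTop_succ_le_of_notMem_minimalPrimes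
        fun _ hp => hx.notMem_of_mem_minimalPrimes hp) hdim)
    have hH := isArtinian_succ hxa hx hart
    refine ⟨hH, exists_pow_le_sup_annihilator
      (fun y => exists_maximalIdeal_pow_smul_eq_zero y) a s fun h hh r hr => ?_⟩
    obtain ⟨δ, hδ⟩ := exists_range_eq_ker_lsmul hx a d
    obtain ⟨y, rfl⟩ : h ∈ LinearMap.range δ := hδ ▸ hh x hxa
    obtain ⟨α, hα, β, hβ, rfl⟩ := Submodule.mem_sup.1 (hs hr)
    rw [add_smul, hh α hα, ← map_smul, Module.mem_annihilator.1 hβ, _root_.map_zero, add_zero]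

/-- The vanishing half of the Lichtenbaum–Hartshorne theorem over a complete local ring: a prime
`q` of dimension `d` with nonvanishing top local cohomology of `R ⧸ q` is such that `a + q`
contains a power of the maximal ideal. -/
theorem LC.exists_pow_le_of_nontrivial [IsNoetherianRing R]
    [IsPrecomplete (IsLocalRing.maximalIdeal R) R] (a : Ideal R) (d : ℕ) (q : Ideal R) [q.IsPrime]
    (hd : ringKrullDim (R ⧸ q) ≤ d) (h : Nontrivial (LC a d (R ⧸ q))) :
    ringKrullDim (R ⧸ q) = d ∧ ∃ s : ℕ, IsLocalRing.maximalIdeal R ^ s ≤ a ⊔ q := by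
  have hdim : ∀ I : Ideal R, Module.supportDim R (R ⧸ I) = ringKrullDim (R ⧸ I) :=
    fun I => Module.supportDim_quotient_eq_ringKrullDim I
  refine ⟨le_antisymm hd (not_lt.1 fun hlt => ?_), ?_⟩
  · exact not_subsingleton (LC a d (R ⧸ q)) (subsingleton_of_supportDim_lt a _ d (hdim q ▸ hlt))
  · obtain ⟨-, s, hs⟩ := isArtinian_and_exists_pow_le a d (R ⧸ q)
      (lt_add_one_of_le' (hdim q ▸ hd))
    refine ⟨s, hs.trans (sup_le_sup_left (fun r hr => ?_) _)⟩
    by_contra hrq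
    have hreg := isSMulRegular_quotient_of_notMem hrq
    refine not_subsingleton (LC a d (R ⧸ q)) ⟨fun x y => ?_⟩
    have hs := smul_surjective hreg a d
      (subsingleton_of_supportDim_lt a _ d (supportDim_quotSMulTop_lt hreg (hdim q ▸ hd)))
    obtain ⟨x, rfl⟩ := hs x
    obtain ⟨y, rfl⟩ := hs y
    rw [Module.mem_annihilator.1 hr, Module.mem_annihilator.1 hr]

end Lichtenbaum

section Dimension

variable {R : Type} [CommRing R]

/-- The dimension of `R ⧸ I` is attained modulo a prime containing `I`. -/
lemma exists_prime_le_ringKrullDim (I : Ideal R) (d : ℕ) (h : (d : WithBot ℕ∞) ≤ ringKrullDim (R ⧸ I)) :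
    ∃ p : Ideal R, p.IsPrime ∧ I ≤ p ∧ (d : WithBot ℕ∞) ≤ ringKrullDim (R ⧸ p) := by
  rw [ringKrullDim_quotient, Order.le_krullDim_iff] at h
  obtain ⟨l, rfl⟩ := h
  refine ⟨l.head.1.asIdeal, l.head.1.2, l.head.2, ?_⟩
  rw [ringKrullDim_quotient, Order.le_krullDim_iff]
  exact ⟨⟨l.length, fun i => ⟨(l i).1, LTSeries.head_le l i⟩, fun i => l.step i⟩, rfl⟩

lemma exists_surjective_quotSMulTop {p q : Ideal R} (h : p ≤ q) {r : R} (hr : r ∈ q) :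
    ∃ f : QuotSMulTop r (R ⧸ p) →ₗ[R] R ⧸ q, Function.Surjective f := by
  refine ⟨Submodule.liftQ _ (Submodule.factor h) ?_, ?_⟩
  · rintro _ ⟨y, -, rfl⟩
    rw [LinearMap.mem_ker, DistribSMul.toLinearMap_apply, map_smul, Algebra.smul_def,
      Ideal.Quotient.algebraMap_eq, Ideal.Quotient.eq_zero_iff_mem.2 hr, zero_mul]
  · intro x
    obtain ⟨y, rfl⟩ := Submodule.factor_surjective h x
    exact ⟨Submodule.Quotient.mk y, rfl⟩

lemma ringKrullDim_add_one_le_of_lt [IsNoetherianRing R] {p q : Ideal R} [p.IsPrime] (h : p < q) :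
    ringKrullDim (R ⧸ q) + 1 ≤ ringKrullDim (R ⧸ p) := by
  obtain ⟨r, hrq, hrp⟩ := SetLike.exists_of_lt h
  obtain ⟨f, hf⟩ := exists_surjective_quotSMulTop h.le hrq
  rw [← Module.supportDim_quotient_eq_ringKrullDim, ← Module.supportDim_quotient_eq_ringKrullDim]
  refine le_trans (add_le_add_left (Module.supportDim_le_of_surjective f hf) 1) ?_
  exact Module.supportDim_quotSMulTop_succ_le_of_notMem_minimalPrimes
    fun _ hp => (isSMulRegular_quotient_of_notMem hrp).notMem_of_mem_minimalPrimes hp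

lemma le_of_add_one_le_add_one {x : WithBot ℕ∞} {n : ℕ} (h : x + 1 ≤ (n + 1 : ℕ)) : x ≤ n :=
  le_of_lt_add_one' (lt_of_add_one_le h (by exact_mod_cast (n + 1).lt_succ_self))

lemma span_sup_le_annihilator_quotSMulTop (q : Ideal R) (r : R) :
    q ⊔ Ideal.span {r} ≤ Module.annihilator R (QuotSMulTop r (R ⧸ q)) := by
  refine sup_le (fun x hx => ?_) ((Ideal.span_singleton_le_iff_mem _).2 ?_)
  · refine Module.mem_annihilator.2 fun y => ?_
    obtain ⟨y, rfl⟩ := Submodule.mkQ_surjective _ y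
    rw [← map_smul, Algebra.smul_def, Ideal.Quotient.algebraMap_eq,
      Ideal.Quotient.eq_zero_iff_mem.2 hx, zero_mul, map_zero]
  · refine Module.mem_annihilator.2 fun y => ?_
    obtain ⟨y, rfl⟩ := Submodule.mkQ_surjective _ y
    rw [← map_smul, Submodule.mkQ_apply, Submodule.Quotient.mk_eq_zero]
    exact Submodule.smul_mem_pointwise_smul _ _ _ trivial

/-- Cutting a local domain by a nonzero nonunit leaves a prime of dimension one less. -/
lemma exists_prime_of_notMem [IsLocalRing R] [IsNoetherianRing R] (q : Ideal R) [q.IsPrime] (d : ℕ)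
    (hd : ringKrullDim (R ⧸ q) = (d + 1 : ℕ)) (r : R) (hr : r ∈ IsLocalRing.maximalIdeal R)
    (hrq : r ∉ q) : ∃ p : Ideal R, p.IsPrime ∧ q ⊔ Ideal.span {r} ≤ p ∧ q < p ∧
      ringKrullDim (R ⧸ p) = d := by
  obtain ⟨p, hp, hle, hdim⟩ := exists_prime_le_ringKrullDim
    (Module.annihilator R (QuotSMulTop r (R ⧸ q))) d (by
      rw [← Module.supportDim_eq_ringKrullDim_quotient_annihilator]
      have := Module.supportDim_quotSMulTop_succ_eq_supportDim
        (isSMulRegular_quotient_of_notMem hrq) hr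
      rw [Module.supportDim_quotient_eq_ringKrullDim, hd] at this
      by_contra hlt
      have h1 : (d : WithBot ℕ∞) + 1 ≤ Module.supportDim R (QuotSMulTop r (R ⧸ q)) + 1 := by
        rw [this]; exact_mod_cast le_rfl
      have h2 : Module.supportDim R (QuotSMulTop r (R ⧸ q)) + 1 < (d + 1 : ℕ) := by
        revert hlt
        induction Module.supportDim R (QuotSMulTop r (R ⧸ q)) with
        | bot => intro _; exact WithBot.bot_lt_coe _
        | coe x =>
          intro hlt
          have h3 : x < d := by
            have := not_le.1 hlt
            exact_mod_cast this
          have : x + 1 < (d + 1 : ℕ) := by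
            rw [Nat.cast_add, Nat.cast_one]
            exact (ENat.add_lt_add_iff_right (by simp)).2 h3
          exact_mod_cast this
      exact absurd this h2.ne)
  have hlt : q < p := lt_of_le_of_ne
    (le_sup_left.trans ((span_sup_le_annihilator_quotSMulTop q r).trans hle)) (by
      rintro rfl
      exact hrq (hle (span_sup_le_annihilator_quotSMulTop _ r
        (Ideal.mem_sup_right (Ideal.mem_span_singleton_self r)))))
  exact ⟨p, hp, (span_sup_le_annihilator_quotSMulTop q r).trans hle, hlt, le_antisymm
    (le_of_add_one_le_add_one (hd ▸ ringKrullDim_add_one_le_of_lt hlt)) hdim⟩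

lemma ringKrullDim_quotient_maximalIdeal [IsLocalRing R] :
    ringKrullDim (R ⧸ IsLocalRing.maximalIdeal R) = 0 :=
  letI := Ideal.Quotient.field (IsLocalRing.maximalIdeal R)
  ringKrullDim_eq_zero_of_field _

/-- In a local domain of dimension at least two, there are primes of dimension one less
avoiding a given nonzero nonunit. -/
lemma exists_prime_notMem [IsLocalRing R] [IsNoetherianRing R] (q : Ideal R) [q.IsPrime] (d : ℕ)
    (hd : ringKrullDim (R ⧸ q) = (d + 2 : ℕ)) (r : R) (hr : r ∈ IsLocalRing.maximalIdeal R)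
    (hrq : r ∉ q) : ∃ p : Ideal R, p.IsPrime ∧ q < p ∧ r ∉ p ∧
      ringKrullDim (R ⧸ p) = (d + 1 : ℕ) := by
  set m := IsLocalRing.maximalIdeal R
  set J := q ⊔ Ideal.span {r}
  have hqJ : q < J := lt_of_le_of_ne le_sup_left fun h => hrq
    (h ▸ Ideal.mem_sup_right (Ideal.mem_span_singleton_self r))
  have hJm : J ≤ m := sup_le (IsLocalRing.le_maximalIdeal (Ideal.IsPrime.ne_top inferInstance))
    ((Ideal.span_singleton_le_iff_mem _).2 hr)
  have havoid : ¬ ((m : Set R) ⊆ ⋃ p ∈ J.minimalPrimes, (p : Set R)) := by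
    rw [Ideal.subset_union_prime_finite (Ideal.finite_minimalPrimes_of_isNoetherianRing R J) ⊥ ⊥
      fun p hp _ _ => hp.1.1]
    rintro ⟨p, hp, hmp⟩
    obtain ⟨P, hP, hJP, -, hPd⟩ := exists_prime_of_notMem q (d + 1) hd r hr hrq
    have : P = m := le_antisymm (IsLocalRing.le_maximalIdeal hP.ne_top)
      (hmp.trans (hp.2 ⟨hP, hJP⟩ ((IsLocalRing.le_maximalIdeal hP.ne_top).trans hmp)))
    rw [this, ringKrullDim_quotient_maximalIdeal] at hPd
    exact absurd hPd (by exact_mod_cast (Nat.succ_ne_zero d).symm)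
  obtain ⟨z, hzm, hz⟩ := Set.not_subset.1 havoid
  simp only [Set.mem_iUnion, not_exists] at hz
  obtain ⟨p₀, hp₀, -⟩ := Ideal.exists_minimalPrimes_le (J := m) hJm
  have hzq : z ∉ q := fun h => hz p₀ hp₀ (hp₀.1.2 (hqJ.le h))
  obtain ⟨p, hp, hle, hqp, hpd⟩ := exists_prime_of_notMem q (d + 1) hd z hzm hzq
  refine ⟨p, hp, hqp, fun hrp => ?_, hpd⟩
  have hJp : J ≤ p := sup_le hqp.le ((Ideal.span_singleton_le_iff_mem _).2 hrp)
  obtain ⟨p', hp', hp'p⟩ := Ideal.exists_minimalPrimes_le hJp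
  have := hp'.1.1
  have hlt : p' < p := lt_of_le_of_ne hp'p (by
    rintro rfl
    exact hz _ hp' (hle (Ideal.mem_sup_right (Ideal.mem_span_singleton_self z))))
  have h1 := ringKrullDim_add_one_le_of_lt hlt
  have h2 := le_of_add_one_le_add_one
    (hd ▸ ringKrullDim_add_one_le_of_lt (lt_of_lt_of_le hqJ hp'.1.2))
  have h3 := le_of_add_one_le_add_one (h1.trans h2)
  rw [hpd] at h3
  exact absurd h3 (by exact_mod_cast Nat.not_succ_le_self d)

end Dimension

section Nonvanishing

variable {R : Type} [CommRing R] [IsLocalRing R] [IsNoetherianRing R]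

omit [IsLocalRing R] in
/-- A surjection onto a quotient with smaller support induces surjections on cohomology. -/
lemma LC.map_surjective_of_supportDim_lt {M N : Type} [AddCommGroup M] [Module R M]
    [Module.Finite R M] [AddCommGroup N] [Module R N] (f : M →ₗ[R] N) (hf : Function.Surjective f)
    (a : Ideal R) (i : ℕ) (hM : Module.supportDim R M < (i + 1 : ℕ)) :
    Function.Surjective (map a i f) :=
  map_surjective (LinearMap.exact_subtype_ker_map f) (Submodule.injective_subtype _) hf
    (subsingleton_of_supportDim_lt a _ _
      ((Module.supportDim_le_of_injective _ (Submodule.injective_subtype _)).trans_lt hM))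

/-- Nonvanishing of top local cohomology of `R ⧸ q` supported at the closed point. -/
theorem LC.nontrivial_of_pow_le (a : Ideal R) (d : ℕ) (q : Ideal R) [q.IsPrime]
    (ha : a ≤ IsLocalRing.maximalIdeal R) (hd : ringKrullDim (R ⧸ q) = d) (s : ℕ)
    (hs : IsLocalRing.maximalIdeal R ^ s ≤ a ⊔ q) : Nontrivial (LC a d (R ⧸ q)) := by
  set m := IsLocalRing.maximalIdeal R
  induction d generalizing q with
  | zero =>
    by_contra h
    rw [not_nontrivial_iff_subsingleton, subsingleton_zero_iff] at h
    have hqm : m = q := by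
      by_contra hne
      obtain ⟨h1⟩ : Nonempty (q < m) := ⟨lt_of_le_of_ne
        (IsLocalRing.le_maximalIdeal (Ideal.IsPrime.ne_top inferInstance)) (Ne.symm hne)⟩
      have := ringKrullDim_add_one_le_of_lt h1
      rw [hd, ringKrullDim_quotient_maximalIdeal] at this
      exact absurd this (by decide)
    have h1 : (1 : R ⧸ q) ∈ torsion a (R ⧸ q) := ⟨1, fun r hr => by
      rw [pow_one] at hr
      rw [Algebra.smul_def, mul_one, Ideal.Quotient.algebraMap_eq,
        Ideal.Quotient.eq_zero_iff_mem.2 (hqm ▸ ha hr)]⟩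
    rw [h, Submodule.mem_bot] at h1
    exact one_ne_zero h1
  | succ d ih =>
    by_contra h
    rw [not_nontrivial_iff_subsingleton] at h
    have hsurj : ∀ p : Ideal R, p.IsPrime → q < p →
        ∃ φ : LC a d (R ⧸ q) →ₗ[R] LC a d (R ⧸ p), Function.Surjective φ := by
      intro p hp hqp
      obtain ⟨r, hrp, hrq⟩ := SetLike.exists_of_lt hqp
      obtain ⟨f, hf⟩ := exists_surjective_quotSMulTop hqp.le hrp
      have hreg := isSMulRegular_quotient_of_notMem hrq
      refine ⟨map a d f ∘ₗ map a d (Submodule.mkQ _),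
        (map_surjective_of_supportDim_lt f hf a d ?_).comp
          (map_surjective (exact_lsmul_mkQ (R ⧸ q) r) hreg (Submodule.mkQ_surjective _) h)⟩
      exact supportDim_quotSMulTop_lt hreg (Module.supportDim_quotient_eq_ringKrullDim q ▸ hd.le)
    have hnt : ∀ p : Ideal R, p.IsPrime → q < p → ringKrullDim (R ⧸ p) = d →
        Nontrivial (LC a d (R ⧸ p)) := fun p hp hqp hpd =>
      ih p hpd (hs.trans (sup_le_sup_left hqp.le _))
    have hqm : q < m := lt_of_le_of_ne
      (IsLocalRing.le_maximalIdeal (Ideal.IsPrime.ne_top inferInstance)) (by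
        rintro rfl
        rw [ringKrullDim_quotient_maximalIdeal] at hd
        exact absurd hd (by exact_mod_cast (Nat.succ_ne_zero d).symm))
    cases d with
    | zero =>
      have haq : ¬ a ≤ q := fun h => hqm.not_ge
        (Ideal.IsPrime.le_of_pow_le (hs.trans (sup_le h le_rfl)))
      obtain ⟨t, hta, htq⟩ := SetLike.not_le_iff_exists.1 haq
      obtain ⟨p, hp, -, hqp, hpd⟩ := exists_prime_of_notMem q 0 hd t (ha hta) htq
      obtain ⟨φ, hφ⟩ := hsurj p hp hqp
      have : Subsingleton (LC a 0 (R ⧸ q)) := by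
        rw [subsingleton_zero_iff, eq_bot_iff]
        rintro x ⟨n, hn⟩
        exact (isSMulRegular_quotient_of_notMem fun hh =>
          htq (Ideal.IsPrime.mem_of_pow_mem inferInstance n hh)).right_eq_zero_of_smul
            (hn _ (Ideal.pow_mem_pow hta n))
      have := hnt p hp hqp hpd
      exact not_subsingleton _ hφ.subsingleton
    | succ d =>
      have hart : IsArtinian R (LC a (d + 1) (R ⧸ q)) :=
        isArtinian_of_pow_le a (d + 1) (R ⧸ q) s (by rwa [Ideal.annihilator_quotient])
      obtain ⟨r₁, hr₁m, hr₁q⟩ := SetLike.exists_of_lt hqm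
      obtain ⟨_, ⟨r₀, ⟨hr₀m, hr₀q⟩, rfl⟩, hmin⟩ := IsArtinian.set_has_minimal
        ((fun r => LinearMap.range (LinearMap.lsmul R (LC a (d + 1) (R ⧸ q)) r)) ''
          {r | r ∈ m ∧ r ∉ q}) ⟨_, r₁, ⟨hr₁m, hr₁q⟩, rfl⟩
      obtain ⟨p, hp, hqp, hr₀p, hpd⟩ := exists_prime_notMem q d hd r₀ hr₀m hr₀q
      obtain ⟨r, hrp, hrq⟩ := SetLike.exists_of_lt hqp
      obtain ⟨φ, hφ⟩ := hsurj p hp hqp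
      have := hnt p hp hqp hpd
      refine not_subsingleton (LC a (d + 1) (R ⧸ p)) (subsingleton_of_forall_eq 0 fun y => ?_)
      have hreg := isSMulRegular_quotient_of_notMem hr₀p
      obtain ⟨y, rfl⟩ := smul_surjective hreg a (d + 1) (subsingleton_of_supportDim_lt a _ _
        (supportDim_quotSMulTop_lt hreg (Module.supportDim_quotient_eq_ringKrullDim p ▸ hpd.le))) y
      obtain ⟨x, rfl⟩ := hφ y
      have hle : LinearMap.range (LinearMap.lsmul R (LC a (d + 1) (R ⧸ q)) (r₀ * r)) ≤
          LinearMap.range (LinearMap.lsmul R (LC a (d + 1) (R ⧸ q)) r₀) := by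
        rintro _ ⟨z, rfl⟩
        exact ⟨r • z, (mul_smul r₀ r z).symm⟩
      have heq := hle.eq_of_not_lt (hmin _ ⟨r₀ * r, ⟨Ideal.mul_mem_right _ _ hr₀m, fun hh =>
        (Ideal.IsPrime.mem_or_mem inferInstance hh).elim hr₀q hrq⟩, rfl⟩)
      obtain ⟨z, hz⟩ : r₀ • x ∈
          LinearMap.range (LinearMap.lsmul R (LC a (d + 1) (R ⧸ q)) (r₀ * r)) :=
        heq ▸ ⟨x, rfl⟩
      rw [← map_smul, ← hz, LinearMap.lsmul_apply, mul_comm, mul_smul, map_smul]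
      refine smul_eq_zero_of_smul_eq_zero (fun w => ?_) _
      rw [Algebra.smul_def, Ideal.Quotient.algebraMap_eq, Ideal.Quotient.eq_zero_iff_mem.2 hrp,
        zero_mul]

end Nonvanishing

section FiniteSubmodules

variable {R : Type} [CommRing R] [IsNoetherianRing R]

omit [IsNoetherianRing R] in
lemma mk₀_comp_mk₀_inclusion {M : Type} [AddCommGroup M] [Module R M] {N₀ N₁ N₂ : Submodule R M}
    (h : N₀ ≤ N₁) (h' : N₁ ≤ N₂) {X : ModuleCat.{0} R} {i : ℕ}
    (e : Abelian.Ext X (ModuleCat.of R N₀) i) :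
    (e.comp (Abelian.Ext.mk₀ (ModuleCat.ofHom (Submodule.inclusion h))) (add_zero i)).comp
      (Abelian.Ext.mk₀ (ModuleCat.ofHom (Submodule.inclusion h'))) (add_zero i) =
    e.comp (Abelian.Ext.mk₀ (ModuleCat.ofHom (Submodule.inclusion (h.trans h'))))
      (add_zero i) := by
  rw [Abelian.Ext.comp_assoc (h := by lia) (h₁₂ := add_zero i) (h₂₃ := add_zero 0),
    Abelian.Ext.mk₀_comp_mk₀]
  rfl

omit [IsNoetherianRing R] in
lemma mk₀_inclusion_comp_mk₀_subtype {M : Type} [AddCommGroup M] [Module R M]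
    {N₀ N₁ : Submodule R M}
    (h : N₀ ≤ N₁) {X : ModuleCat.{0} R} {i : ℕ}
    (e : Abelian.Ext X (ModuleCat.of R N₀) i) :
    (e.comp (Abelian.Ext.mk₀ (ModuleCat.ofHom (Submodule.inclusion h))) (add_zero i)).comp
      (Abelian.Ext.mk₀ (ModuleCat.ofHom N₁.subtype)) (add_zero i) =
    e.comp (Abelian.Ext.mk₀ (ModuleCat.ofHom N₀.subtype)) (add_zero i) := by
  rw [Abelian.Ext.comp_assoc (h := by lia) (h₁₂ := add_zero i) (h₂₃ := add_zero 0),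
    Abelian.Ext.mk₀_comp_mk₀]
  rfl

/-- `Ext` out of a finite module commutes with the filtered union of finite submodules. -/
lemma ext_finite_submodule (i : ℕ) : ∀ (X N : Type) [AddCommGroup X] [Module R X]
    [Module.Finite R X] [AddCommGroup N] [Module R N],
    (∀ e : Abelian.Ext (ModuleCat.of R X) (ModuleCat.of R N) i, ∃ N₀ : Submodule R N, N₀.FG ∧
      ∃ e₀ : Abelian.Ext (ModuleCat.of R X) (ModuleCat.of R N₀) i,
        e₀.comp (Abelian.Ext.mk₀ (ModuleCat.ofHom N₀.subtype)) (add_zero i) = e) ∧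
    (∀ N₀ : Submodule R N, N₀.FG → ∀ e₀ : Abelian.Ext (ModuleCat.of R X) (ModuleCat.of R N₀) i,
      e₀.comp (Abelian.Ext.mk₀ (ModuleCat.ofHom N₀.subtype)) (add_zero i) = 0 →
      ∃ (N₁ : Submodule R N) (h : N₀ ≤ N₁), N₁.FG ∧
        e₀.comp (Abelian.Ext.mk₀ (ModuleCat.ofHom (Submodule.inclusion h))) (add_zero i) = 0) := by
  induction i with
  | zero =>
    intro X N _ _ _ _ _
    constructor
    · intro e
      obtain ⟨f, rfl⟩ := (Abelian.Ext.mk₀_bijective _ _).2 e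
      refine ⟨LinearMap.range f.hom, Module.Finite.iff_fg.1 inferInstance,
        Abelian.Ext.mk₀ (ModuleCat.ofHom f.hom.rangeRestrict), ?_⟩
      rw [Abelian.Ext.mk₀_comp_mk₀]
      rfl
    · intro N₀ hN₀ e₀ h
      refine ⟨N₀, le_rfl, hN₀, ?_⟩
      obtain ⟨f, rfl⟩ := (Abelian.Ext.mk₀_bijective _ _).2 e₀
      rw [Abelian.Ext.mk₀_comp_mk₀, Abelian.Ext.mk₀_eq_zero_iff] at h
      have hf : f = 0 := by
        apply ModuleCat.hom_ext
        ext x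
        exact congrArg (fun t => t.hom x) h
      rw [hf]
      simp
  | succ i ih =>
    intro X N _ _ _ _ _
    obtain ⟨k, π, hπ⟩ := Module.Finite.exists_fin' R X
    have hS := LC.shortExact (LinearMap.ker π).subtype π (LinearMap.exact_subtype_ker_map π)
      (Submodule.injective_subtype _) hπ
    let δ : Abelian.Ext (ModuleCat.of R X) (ModuleCat.of R (LinearMap.ker π)) 1 := hS.extClass
    let ι : Abelian.Ext (ModuleCat.of R (LinearMap.ker π)) (ModuleCat.of R (Fin k → R)) 0 :=
      Abelian.Ext.mk₀ (ModuleCat.ofHom (LinearMap.ker π).subtype)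
    have hδι : δ.comp ι (add_zero 1) = 0 := hS.extClass_comp
    have : Projective (ModuleCat.of R (Fin k → R)) :=
      ModuleCat.projective_of_free (Pi.basisFun R (Fin k))
    have hδ : ∀ (Y : Type) [AddCommGroup Y] [Module R Y]
        (e : Abelian.Ext (ModuleCat.of R X) (ModuleCat.of R Y) (i + 1)),
        ∃ e' : Abelian.Ext (ModuleCat.of R (LinearMap.ker π)) (ModuleCat.of R Y) i,
          δ.comp e' (add_comm 1 i) = e := fun Y _ _ e =>
      Abelian.Ext.contravariant_sequence_exact₃ hS _ e
        (Abelian.Ext.eq_zero_of_projective (P := ModuleCat.of R (Fin k → R)) _) (add_comm 1 i)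
    constructor
    · intro e
      obtain ⟨e', rfl⟩ := hδ _ e
      obtain ⟨N₀, hN₀, e₀, rfl⟩ := (ih (LinearMap.ker π) N).1 e'
      refine ⟨N₀, hN₀, δ.comp e₀ (add_comm 1 i), ?_⟩
      exact Abelian.Ext.comp_assoc (h := by lia) ..
    · intro N₀ hN₀ e₀ h
      obtain ⟨e', rfl⟩ := hδ _ e₀
      rw [Abelian.Ext.comp_assoc (h := by lia) (h₁₂ := add_comm 1 i) (h₂₃ := add_zero i)] at h
      obtain ⟨g, hg⟩ := Abelian.Ext.contravariant_sequence_exact₁ hS _ _ _ h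
      obtain ⟨N', hN', g₀, rfl⟩ := (ih (Fin k → R) N).1 g
      have hg' : e'.comp (Abelian.Ext.mk₀ (ModuleCat.ofHom N₀.subtype)) (add_zero i) =
        ι.comp (g₀.comp (Abelian.Ext.mk₀ (ModuleCat.ofHom N'.subtype)) (add_zero i))
          (zero_add i) := hg.symm
      obtain ⟨N₁, h₁, hN₁, hx⟩ := (ih (LinearMap.ker π) N).2 (N₀ ⊔ N') (hN₀.sup hN')
        (e'.comp (Abelian.Ext.mk₀ (ModuleCat.ofHom (Submodule.inclusion le_sup_left)))
          (add_zero i) -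
        (ι.comp g₀ (zero_add i)).comp
          (Abelian.Ext.mk₀ (ModuleCat.ofHom (Submodule.inclusion le_sup_right)))
          (add_zero i)) (by
          rw [sub_eq_add_neg, Abelian.Ext.add_comp, Abelian.Ext.neg_comp,
            ← sub_eq_add_neg, mk₀_inclusion_comp_mk₀_subtype,
            mk₀_inclusion_comp_mk₀_subtype, hg',
            Abelian.Ext.comp_assoc (h := by lia) (h₁₂ := zero_add i) (h₂₃ := add_zero i), sub_self])
      refine ⟨N₁, le_sup_left.trans h₁, hN₁, ?_⟩
      rw [sub_eq_add_neg, Abelian.Ext.add_comp, Abelian.Ext.neg_comp,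
            ← sub_eq_add_neg, mk₀_comp_mk₀_inclusion, mk₀_comp_mk₀_inclusion, sub_eq_zero] at hx
      rw [Abelian.Ext.comp_assoc (h := by lia) (h₁₂ := add_comm 1 i) (h₂₃ := add_zero i), hx,
        Abelian.Ext.comp_assoc (h := by lia) (h₁₂ := zero_add i) (h₂₃ := add_zero i),
        ← Abelian.Ext.comp_assoc (h := by lia) (h₁₂ := add_zero 1) (h₂₃ := zero_add i), hδι]
      simp

namespace LC

variable {a : Ideal R} {i : ℕ} {N : Type} [AddCommGroup N] [Module R N]

lemma exists_finite_submodule (x : LC a i N) :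
    ∃ N₀ : Submodule R N, N₀.FG ∧ ∃ x₀ : LC a i N₀, map a i N₀.subtype x₀ = x := by
  obtain ⟨n, e, rfl⟩ := x.exists_of
  obtain ⟨N₀, h, e₀, rfl⟩ := (ext_finite_submodule i _ _).1 e
  exact ⟨N₀, h, of a i N₀ n e₀, map_of _ _ _⟩

lemma exists_finite_submodule_of_map_eq_zero (N₀ : Submodule R N) (hN₀ : N₀.FG) (x : LC a i N₀)
    (hx : map a i N₀.subtype x = 0) :
    ∃ (N₁ : Submodule R N) (h : N₀ ≤ N₁), N₁.FG ∧ map a i (Submodule.inclusion h) x = 0 := by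
  obtain ⟨n, e, rfl⟩ := x.exists_of
  rw [map_of] at hx
  obtain ⟨m, h, hm⟩ := exists_trans_eq_zero hx
  rw [extTrans_apply, ← Abelian.Ext.comp_assoc (h := by simp) (h₁₂ := zero_add i)
    (h₂₃ := by simp)] at hm
  obtain ⟨N₁, h₁, hN₁, hz⟩ := (ext_finite_submodule i _ _).2 N₀ hN₀ _ hm
  refine ⟨N₁, h₁, hN₁, ?_⟩
  rw [← of_trans h, map_of, extTrans_apply]
  exact (congrArg _ hz).trans (_root_.map_zero _)

/-- Cohomology vanishes as soon as it vanishes on all finite submodules. -/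
lemma subsingleton_of_finite_submodule (h : ∀ N₀ : Submodule R N, N₀.FG → Subsingleton (LC a i N₀)) :
    Subsingleton (LC a i N) := by
  refine subsingleton_of_forall_eq 0 fun x => ?_
  obtain ⟨N₀, hN₀, x₀, rfl⟩ := exists_finite_submodule x
  have := h N₀ hN₀
  rw [Subsingleton.elim x₀ 0, _root_.map_zero]

end LC

end FiniteSubmodules

section TopCohomology

variable {R : Type} [CommRing R] [IsNoetherianRing R]

namespace LC

omit [IsNoetherianRing R] in
lemma subsingleton_prod {a : Ideal R} {i : ℕ} {M N : Type} [AddCommGroup M] [Module R M]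
    [AddCommGroup N] [Module R N] (hM : Subsingleton (LC a i M)) (hN : Subsingleton (LC a i N)) :
    Subsingleton (LC a i (M × N)) :=
  subsingleton_mid (f := LinearMap.inl R M N) (g := LinearMap.snd R M N) .inl_snd
    LinearMap.inl_injective LinearMap.snd_surjective hM hN

omit [IsNoetherianRing R] in
lemma subsingleton_pi {a : Ideal R} {i : ℕ} {M : Type} [AddCommGroup M] [Module R M]
    (hM : Subsingleton (LC a i M)) (n : ℕ) : Subsingleton (LC a i (Fin n → M)) := by
  induction n with
  | zero => infer_instance
  | succ n ih =>
    have := subsingleton_prod hM ih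
    exact (congr a i (Fin.consLinearEquiv R fun _ : Fin (n + 1) => M)).symm.toEquiv.subsingleton

/-- If the top local cohomology of `R ⧸ P` vanishes, so does that of every module over it. -/
lemma subsingleton_of_forall_smul_eq_zero (a : Ideal R) (d : ℕ) (P : Ideal R)
    (hd : ringKrullDim (R ⧸ P) ≤ d) (h : Subsingleton (LC a d (R ⧸ P)))
    (N : Type) [AddCommGroup N] [Module R N] (hN : ∀ r ∈ P, ∀ x : N, r • x = 0) :
    Subsingleton (LC a d N) := by
  refine subsingleton_of_finite_submodule fun N₀ hN₀ => ?_
  have : Module.Finite R N₀ := Module.Finite.iff_fg.2 hN₀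
  have hT : Module.IsTorsionBySet R N₀ P := fun x r => Subtype.ext (hN r r.2 x)
  let _ := hT.module
  have : IsScalarTower R (R ⧸ P) N₀ := hT.isScalarTower
  have : Module.Finite (R ⧸ P) N₀ := Module.Finite.of_restrictScalars_finite R _ _
  obtain ⟨n, f, hf⟩ := Module.Finite.exists_fin' (R ⧸ P) N₀
  have h1 := subsingleton_pi h n
  have h2 : Module.supportDim R (Fin n → R ⧸ P) ≤ d := by
    rw [Module.supportDim_eq_ringKrullDim_quotient_annihilator]
    refine le_trans ?_ hd
    refine ringKrullDim_le_of_surjective (Ideal.Quotient.factor (fun r hr => ?_))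
      (Ideal.Quotient.factor_surjective _)
    rw [Module.mem_annihilator]
    intro x
    ext j
    rw [Pi.smul_apply, Algebra.smul_def, Ideal.Quotient.algebraMap_eq,
      Ideal.Quotient.eq_zero_iff_mem.2 hr, zero_mul]
    rfl
  exact (map_surjective_of_supportDim_lt (f.restrictScalars R) hf a d
    (lt_add_one_of_le' h2)).subsingleton

lemma le_ringKrullDim_of_nontrivial (a : Ideal R) (d : ℕ) (P : Ideal R)
    (N : Type) [AddCommGroup N] [Module R N] (hN : ∀ r ∈ P, ∀ x : N, r • x = 0)
    (h : Nontrivial (LC a d N)) : d ≤ ringKrullDim (R ⧸ P) := by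
  by_contra hlt
  rw [not_le] at hlt
  refine not_subsingleton_iff_nontrivial.2 h
    (subsingleton_of_forall_smul_eq_zero a d P hlt.le ?_ N hN)
  exact subsingleton_of_supportDim_lt a _ d (by rwa [Module.supportDim_quotient_eq_ringKrullDim])

/-- Vanishing of cohomology can be checked on the primes containing the annihilator. -/
lemma subsingleton_of_forall_prime (a : Ideal R) (d : ℕ) (M : Type) [AddCommGroup M] [Module R M]
    [hM : Module.Finite R M] (h : ∀ q : Ideal R, q.IsPrime → Module.annihilator R M ≤ q →
      Subsingleton (LC a d (R ⧸ q))) : Subsingleton (LC a d M) := by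
  revert h
  induction hM using IsNoetherianRing.induction_on_isQuotientEquivQuotientPrime R with
  | subsingleton N => exact fun _ => inferInstance
  | quotient N p e =>
    intro h
    have := h p.1 p.2 (by rw [e.annihilator_eq, Ideal.annihilator_quotient])
    exact (congr a d e).toEquiv.subsingleton
  | exact N₁ N₂ N₃ f g hf hg hfg h₁ h₃ =>
    intro h
    refine subsingleton_mid hfg hf hg
      (h₁ fun q hq hle => h q hq ((f.annihilator_le_of_injective hf).trans hle))
      (h₃ fun q hq hle => h q hq ((g.annihilator_le_of_surjective hg).trans hle))

end LC

end TopCohomology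

section Retraction

variable {B : Type} [CommRing B] [IsLocalRing B] [IsNoetherianRing B]

open IsLocalRing

omit [IsLocalRing B] in
lemma exists_pow_forall_mem_smul_top (Ω M : Type) [AddCommGroup Ω] [Module B Ω] [Module.Finite B Ω]
    [AddCommGroup M] [Module B M] [Module.Finite B M] (I : Ideal B) (n : ℕ) :
    ∃ k, ∀ f : Ω →ₗ[B] M, (∀ x, f x ∈ (I ^ k • ⊤ : Submodule B M)) →
      f ∈ (I ^ n • ⊤ : Submodule B (Ω →ₗ[B] M)) := by
  obtain ⟨t, π, hπ⟩ := Module.Finite.exists_fin' B Ω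
  let φ : (Ω →ₗ[B] M) →ₗ[B] (Fin t → M) :=
    LinearMap.pi fun j => LinearMap.applyₗ (π (Pi.single j 1))
  have hφ : Function.Injective φ := by
    intro f g h
    have h1 : f ∘ₗ π = g ∘ₗ π := by
      apply LinearMap.pi_ext'
      intro j
      ext
      exact congrFun h j
    exact LinearMap.ext fun x => by
      obtain ⟨y, rfl⟩ := hπ x
      exact LinearMap.congr_fun h1 y
  obtain ⟨k, hk⟩ := Ideal.exists_pow_inf_eq_pow_smul I (LinearMap.range φ)
  refine ⟨n + k, fun f hf => ?_⟩
  have h1 : φ f ∈ (I ^ (n + k) • ⊤ ⊓ LinearMap.range φ : Submodule B (Fin t → M)) := by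
    refine ⟨?_, f, rfl⟩
    have h2 : φ f = ∑ j, LinearMap.single B (fun _ => M) j (φ f j) := by
      ext j
      simp [Finset.sum_apply, Pi.single_apply]
    rw [h2]
    refine Submodule.sum_mem _ fun j _ => ?_
    have := Submodule.mem_map_of_mem (f := LinearMap.single B (fun _ => M) j)
      (hf (π (Pi.single j 1)))
    rw [Submodule.map_smul''] at this
    exact Submodule.smul_mono le_rfl le_top this
  rw [hk _ (by lia), Nat.add_sub_cancel] at h1
  have h2 := Submodule.smul_mono (le_refl (I ^ n))
    (inf_le_right : I ^ k • ⊤ ⊓ LinearMap.range φ ≤ _) h1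
  rw [← Submodule.map_top, ← Submodule.map_smul''] at h2
  obtain ⟨g, hg, hgf⟩ := h2
  exact hφ hgf ▸ hg

/-- An injection of finite modules splits if it splits modulo all powers of the maximal ideal. -/
lemma exists_leftInverse_of_forall_pow {M N : Type} [AddCommGroup M] [Module B M]
    [Module.Finite B M] [AddCommGroup N] [Module B N] [Module.Finite B N] (j : M →ₗ[B] N)
    (hj : Function.Injective j)
    (h : ∀ n : ℕ, ∃ g : N →ₗ[B] M ⧸ (maximalIdeal B ^ n • ⊤ : Submodule B M),
      ∀ x, g (j x) = Submodule.Quotient.mk x) :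
    ∃ r : N →ₗ[B] M, ∀ x, r (j x) = x := by
  obtain ⟨k, π, hπ⟩ := Module.Finite.exists_fin' B N
  let Ω := (LinearMap.range j).comap π
  let f : Ω →ₗ[B] M := (LinearEquiv.ofInjective j hj).symm.toLinearMap ∘ₗ
    π.restrict (p := Ω) (q := LinearMap.range j) (fun x hx => hx)
  have hf : ∀ x : Ω, j (f x) = π x := fun x => by
    have := (LinearEquiv.ofInjective j hj).apply_symm_apply
      (π.restrict (p := Ω) (q := LinearMap.range j) (fun x hx => hx) x)
    exact congrArg Subtype.val this
  let ρ : ((Fin k → B) →ₗ[B] M) →ₗ[B] (Ω →ₗ[B] M) := LinearMap.lcomp B M Ω.subtype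
  have hmem : (LinearMap.range ρ).mkQ f = 0 := by
    have h0 := Ideal.iInf_pow_smul_eq_bot_of_isLocalRing (maximalIdeal B)
      (M := (Ω →ₗ[B] M) ⧸ LinearMap.range ρ) (Ideal.IsPrime.ne_top')
    rw [← Submodule.mem_bot B, ← h0, Submodule.mem_iInf]
    intro n
    obtain ⟨t, ht⟩ := exists_pow_forall_mem_smul_top Ω M (maximalIdeal B) n
    obtain ⟨g, hg⟩ := h t
    obtain ⟨G, hG⟩ := Module.projective_lifting_property
      (Submodule.mkQ (maximalIdeal B ^ t • ⊤ : Submodule B M)) (g ∘ₗ π)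
      (Submodule.mkQ_surjective _)
    have h1 : (LinearMap.range ρ).mkQ f = (LinearMap.range ρ).mkQ (f - ρ G) := by
      rw [map_sub, sub_eq_self.2]
      exact (Submodule.Quotient.mk_eq_zero _).2 ⟨G, rfl⟩
    rw [h1]
    have h2 := Submodule.mem_map_of_mem (f := (LinearMap.range ρ).mkQ) (ht (f - ρ G) (by
      intro x
      rw [← Submodule.Quotient.mk_eq_zero, LinearMap.sub_apply, Submodule.Quotient.mk_sub,
        ← hg, hf, sub_eq_zero]
      exact (LinearMap.congr_fun hG x).symm))
    rw [Submodule.map_smul''] at h2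
    exact Submodule.smul_mono le_rfl le_top h2
  obtain ⟨G, hG⟩ := (Submodule.Quotient.mk_eq_zero _).1 hmem
  have hG' : ∀ x : Ω, G x = f x := fun x => LinearMap.congr_fun hG x
  have hker : LinearMap.ker π ≤ LinearMap.ker G := by
    intro x hx
    have hxΩ : x ∈ Ω := by
      change π x ∈ LinearMap.range j
      rw [LinearMap.mem_ker.1 hx]
      exact zero_mem _
    rw [LinearMap.mem_ker, hG' ⟨x, hxΩ⟩]
    apply hj
    rw [hf, map_zero]
    exact hx
  refine ⟨(LinearMap.ker π).liftQ G hker ∘ₗ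
    (π.quotKerEquivOfSurjective hπ).symm.toLinearMap, fun x => ?_⟩
  obtain ⟨y, hy⟩ := hπ (j x)
  have hyΩ : y ∈ Ω := ⟨x, hy.symm⟩
  have h1 : (π.quotKerEquivOfSurjective hπ).symm (j x) = Submodule.Quotient.mk y := by
    rw [LinearEquiv.symm_apply_eq, ← hy]
    rfl
  rw [LinearMap.comp_apply, LinearEquiv.coe_coe, h1, Submodule.liftQ_apply, hG' ⟨y, hyΩ⟩]
  apply hj
  rw [hf]
  exact hy

/-- Local cohomology of a finite module embeds into that of its completion. -/
lemma LC.subsingleton_of_adicCompletion (a : Ideal B) (i : ℕ) (M : Type) [AddCommGroup M]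
    [Module B M] [Module.Finite B M]
    (h : Subsingleton (LC a i (AdicCompletion (maximalIdeal B) M))) : Subsingleton (LC a i M) := by
  refine subsingleton_of_forall_eq 0 fun x => ?_
  let ι : M →ₗ[B] AdicCompletion (maximalIdeal B) M := AdicCompletion.of (maximalIdeal B) M
  have hι : Function.Injective ι := AdicCompletion.of_injective ..
  let e := LinearEquiv.ofInjective ι hι
  obtain ⟨N, hN, hfg, hx⟩ := exists_finite_submodule_of_map_eq_zero (LinearMap.range ι)
    (Module.Finite.iff_fg.1 inferInstance) (map a i e.toLinearMap x) (Subsingleton.elim _ _)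
  have : Module.Finite B N := Module.Finite.iff_fg.2 hfg
  obtain ⟨r, hr⟩ := exists_leftInverse_of_forall_pow (Submodule.inclusion hN ∘ₗ e.toLinearMap)
    ((Submodule.inclusion_injective hN).comp e.injective) (fun n =>
      ⟨AdicCompletion.eval (maximalIdeal B) M n ∘ₗ N.subtype, fun x => rfl⟩)
  have h1 : r ∘ₗ (Submodule.inclusion hN ∘ₗ e.toLinearMap) = LinearMap.id := LinearMap.ext hr
  have h2 := LinearMap.congr_fun (congrArg (map a i) h1) x
  rw [map_comp, map_comp, LinearMap.comp_apply, LinearMap.comp_apply, hx, _root_.map_zero,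
    map_id] at h2
  exact h2.symm

end Retraction

section BaseChange

variable {B S : Type} [CommRing B] [CommRing S] [Algebra B S]

/-- Injective modules over a flat algebra are injective over the base. -/
lemma injective_of_flat [Module.Flat B S] (J : Type) [AddCommGroup J] [Module S J] [Module B J]
    [IsScalarTower B S J] [Module.Injective S J] : Module.Injective B J := by
  rw [← Module.Baer.iff_injective]
  intro I g
  obtain ⟨h, hh⟩ := Module.Injective.out (R := S)
    ((I.subtype : I →ₗ[B] B).baseChange S)
    (Module.Flat.lTensor_preserves_injective_linearMap (M := S) _ (Submodule.injective_subtype I))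
    (g.liftBaseChange S)
  refine ⟨h.restrictScalars B ∘ₗ TensorProduct.mk B S B 1, fun x hx => ?_⟩
  have := hh (1 ⊗ₜ ⟨x, hx⟩)
  rw [LinearMap.baseChange_tmul, LinearMap.liftBaseChange_tmul, one_smul] at this
  exact this

lemma mem_torsion_map_iff (a : Ideal B) (N : Type) [AddCommGroup N] [Module S N] [Module B N]
    [IsScalarTower B S N] (x : N) :
    x ∈ torsion (a.map (algebraMap B S)) N ↔ x ∈ torsion a N := by
  simp only [mem_torsion]
  refine exists_congr fun n => ?_
  rw [← Ideal.map_pow]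
  constructor
  · intro h r hr
    rw [← algebraMap_smul S r x]
    exact h _ (Ideal.mem_map_of_mem _ hr)
  · intro h r hr
    have hle : (a ^ n).map (algebraMap B S) ≤ LinearMap.ker (LinearMap.toSpanSingleton S N x) := by
      rw [Ideal.map_le_iff_le_comap]
      intro r hr
      rw [Ideal.mem_comap, LinearMap.mem_ker, LinearMap.toSpanSingleton_apply, algebraMap_smul]
      exact h r hr
    exact hle hr

/-- Independence of base for flat algebras. -/
lemma LC.subsingleton_map_iff [Module.Flat B S] (a : Ideal B) (i : ℕ) (N : Type)
    [AddCommGroup N] [Module S N] [Module B N] [IsScalarTower B S N] :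
    Subsingleton (LC (a.map (algebraMap B S)) i N) ↔ Subsingleton (LC a i N) := by
  induction i generalizing N with
  | zero =>
    rw [subsingleton_zero_iff, subsingleton_zero_iff, eq_bot_iff, eq_bot_iff]
    simp only [SetLike.le_def, mem_torsion_map_iff, Submodule.mem_bot]
  | succ i ih =>
    obtain ⟨J, _, _, f, _, hf⟩ := exists_injective_embedding S N
    let _ : Module B J := Module.compHom J (algebraMap B S)
    have : IsScalarTower B S J := IsScalarTower.of_algebraMap_smul fun r x => rfl
    have : Module.Injective B J := injective_of_flat (S := S) J
    let _ : Module B (J ⧸ LinearMap.range f) :=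
      Module.compHom (J ⧸ LinearMap.range f) (algebraMap B S)
    have : IsScalarTower B S (J ⧸ LinearMap.range f) :=
      IsScalarTower.of_algebraMap_smul fun r x => rfl
    let g := (LinearMap.range f).mkQ
    have hfg : Function.Exact f g := LinearMap.exact_map_mkQ_range f
    have hg : Function.Surjective g := Submodule.mkQ_surjective _
    let f' : N →ₗ[B] J := f.restrictScalars B
    let g' : J →ₗ[B] (J ⧸ LinearMap.range f) := g.restrictScalars B
    have hfg' : Function.Exact f' g' := hfg
    cases i with
    | zero =>
      have e1 : Subsingleton (LC (a.map (algebraMap B S)) 1 N) ↔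
          Function.Surjective (map (a.map (algebraMap B S)) 0 g) :=
        ⟨fun h => map_surjective hfg hf hg h,
          fun h => subsingleton_of_map_surjective hfg hf hg subsingleton_of_injective h⟩
      have e2 : Subsingleton (LC a 1 N) ↔ Function.Surjective (map a 0 g') :=
        ⟨fun h => map_surjective hfg' hf hg h,
          fun h => subsingleton_of_map_surjective hfg' hf hg subsingleton_of_injective h⟩
      rw [zero_add, e1, e2, map_zero_surjective_iff, map_zero_surjective_iff]
      simp only [mem_torsion_map_iff]
      rfl
    | succ i =>
      have e1 : Subsingleton (LC (a.map (algebraMap B S)) (i + 2) N) ↔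
          Subsingleton (LC (a.map (algebraMap B S)) (i + 1) (J ⧸ LinearMap.range f)) :=
        ⟨fun h => subsingleton_right hfg hf hg subsingleton_of_injective h,
          fun h => subsingleton_left hfg hf hg h subsingleton_of_injective⟩
      have e2 : Subsingleton (LC a (i + 2) N) ↔
          Subsingleton (LC a (i + 1) (J ⧸ LinearMap.range f)) :=
        ⟨fun h => subsingleton_right hfg' hf hg subsingleton_of_injective h,
          fun h => subsingleton_left hfg' hf hg h subsingleton_of_injective⟩
      exact e1.trans ((ih _).trans e2.symm)

end BaseChange

section CompletionNoetherian

lemma factorPow_comp_quotientMap {A B : Type} [CommRing A] [CommRing B] (φ : A →+* B)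
    (I : Ideal A) (J : Ideal B) (h : I ≤ J.comap φ) {i j : ℕ} (hij : i ≤ j) :
    (Ideal.Quotient.factorPow J hij).comp ((Ideal.quotientMap (J ^ j) φ
      ((Ideal.pow_right_mono h j).trans (Ideal.le_comap_pow φ j))).comp
        (AdicCompletion.evalₐ I j : AdicCompletion I A →+* A ⧸ I ^ j)) =
    (Ideal.quotientMap (J ^ i) φ ((Ideal.pow_right_mono h i).trans (Ideal.le_comap_pow φ i))).comp
        (AdicCompletion.evalₐ I i : AdicCompletion I A →+* A ⧸ I ^ i) := by
  ext x
  obtain ⟨y, rfl⟩ := AdicCompletion.mk_surjective I A x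
  have hy : Ideal.Quotient.mk (I ^ i) (y.val i) = Ideal.Quotient.mk (I ^ i) (y.val j) := by
    rw [Ideal.Quotient.eq]
    simpa using SModEq.sub_mem.1 (y.property hij)
  have hy' := congrArg (Ideal.quotientMap (J ^ i) φ
    ((Ideal.pow_right_mono h i).trans (Ideal.le_comap_pow φ i))) hy
  simp only [Ideal.quotientMap_mk] at hy'
  simp [AdicCompletion.evalₐ_mk, hy']

/-- The ring homomorphism induced on adic completions. -/
noncomputable def adicCompletionMap {A B : Type} [CommRing A] [CommRing B] (φ : A →+* B)
    (I : Ideal A) (J : Ideal B) (h : I ≤ J.comap φ) : AdicCompletion I A →+* AdicCompletion J B :=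
  AdicCompletion.liftRingHom J
    (fun k => (Ideal.quotientMap (J ^ k) φ
      ((Ideal.pow_right_mono h k).trans (Ideal.le_comap_pow φ k))).comp
        (AdicCompletion.evalₐ I k : AdicCompletion I A →+* A ⧸ I ^ k))
    (factorPow_comp_quotientMap φ I J h)

lemma adicCompletionMap_algebraMap {A B : Type} [CommRing A] [CommRing B] (φ : A →+* B)
    (I : Ideal A) (J : Ideal B) (h : I ≤ J.comap φ) (x : A) :
    adicCompletionMap φ I J h (algebraMap A _ x) = algebraMap B _ (φ x) := by
  refine AdicCompletion.ext_evalₐ fun n => ?_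
  refine (AdicCompletion.evalₐ_liftRingHom J _ (factorPow_comp_quotientMap φ I J h) n _).trans ?_
  simp

/-- The completion of a Noetherian ring with respect to an ideal is Noetherian. -/
theorem isNoetherianRing_adicCompletion (B : Type) [CommRing B] [IsNoetherianRing B]
    (J : Ideal B) : IsNoetherianRing (AdicCompletion J B) := by
  obtain ⟨n, x, hx⟩ := Submodule.fg_iff_exists_fin_generating_family.1 (IsNoetherian.noetherian J)
  let A := MvPolynomial (Fin n) B
  let I : Ideal A := MvPolynomial.idealOfVars (Fin n) B
  let φ : A →+* B := (MvPolynomial.aeval x : A →ₐ[B] B)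
  have hI : I.map φ = J := by
    rw [← hx]
    simp only [I, MvPolynomial.idealOfVars]
    rw [Ideal.map_span, ← Set.range_comp]
    congr 2
    ext i
    exact MvPolynomial.aeval_X x i
  have hIfg : I.FG := MvPolynomial.idealOfVars_fg (Fin n) B
  have hJfg : J.FG := IsNoetherian.noetherian J
  have := AdicCompletion.isAdicComplete_self I hIfg
  have := AdicCompletion.isAdicComplete_self J hJfg
  let ψ := adicCompletionMap φ I J (Ideal.map_le_iff_le_comap.1 hI.le)
  have hmap : (I.map (algebraMap A (AdicCompletion I A))).map ψ =
      J.map (algebraMap B (AdicCompletion J B)) := by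
    have hψ : ψ.comp (algebraMap A (AdicCompletion I A)) =
        (algebraMap B (AdicCompletion J B)).comp φ :=
      RingHom.ext fun x => adicCompletionMap_algebraMap φ I J (Ideal.map_le_iff_le_comap.1 hI.le) x
    rw [Ideal.map_map, hψ, ← Ideal.map_map, hI]
  have : IsHausdorff ((I.map (algebraMap A (AdicCompletion I A))).map ψ) (AdicCompletion J B) := by
    rw [hmap]; infer_instance
  have hsurj : Function.Surjective ψ := by
    refine surjective_of_mk_map_comp_surjective ψ (I := I.map (algebraMap A (AdicCompletion I A))) ?_
    intro y
    obtain ⟨y, rfl⟩ := Ideal.Quotient.mk_surjective y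
    obtain ⟨b, hb⟩ := Ideal.Quotient.mk_surjective (AdicCompletion.evalOneₐ J y)
    refine ⟨algebraMap A _ (MvPolynomial.C b), ?_⟩
    rw [RingHom.comp_apply, Ideal.Quotient.eq, hmap, ← AdicCompletion.ker_evalOneₐ_eq_map J hJfg,
      RingHom.mem_ker, map_sub, adicCompletionMap_algebraMap, sub_eq_zero]
    refine Eq.trans ?_ hb
    rw [show φ (MvPolynomial.C b) = b from MvPolynomial.aeval_C x b]
    exact (AdicCompletion.evalOneₐ J).commutes _
  have : IsNoetherianRing (AdicCompletion I A) :=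
    isNoetherianRing_of_ringEquiv _ (MvPowerSeries.toAdicCompletionAlgEquiv (Fin n) B).toRingEquiv
  exact isNoetherianRing_of_surjective _ _ ψ hsurj

end CompletionNoetherian

section Completion

open IsLocalRing

variable {B : Type} [CommRing B] [IsLocalRing B] [IsNoetherianRing B]

/-- The completion of a local ring. -/
abbrev CompletedRing (B : Type) [CommRing B] [IsLocalRing B] : Type :=
  AdicCompletion (maximalIdeal B) B

instance : IsNoetherianRing (AdicCompletion (maximalIdeal B) B) :=
  isNoetherianRing_adicCompletion B _

instance : Module.Flat B (AdicCompletion (maximalIdeal B) B) :=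
  AdicCompletion.flat_of_isNoetherian _

omit [IsNoetherianRing B] in
lemma ringKrullDim_quotient_eq_zero_of_pow_le (I : Ideal B) (hI : I ≤ maximalIdeal B) (s : ℕ)
    (h : maximalIdeal B ^ s ≤ I) : ringKrullDim (B ⧸ I) = 0 := by
  rw [ringKrullDim_quotient]
  have : PrimeSpectrum.zeroLocus (I : Set B) = {closedPoint B} := by
    ext p
    rw [PrimeSpectrum.mem_zeroLocus, SetLike.coe_subset_coe, Set.mem_singleton_iff]
    constructor
    · intro hp
      have : maximalIdeal B ≤ p.asIdeal := p.2.le_of_pow_le (h.trans hp)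
      exact PrimeSpectrum.ext (((maximalIdeal.isMaximal B).eq_of_le p.2.ne_top this).symm)
    · rintro rfl
      exact hI
  rw [this]
  exact Order.krullDim_eq_zero_of_unique

lemma map_le_maximalIdeal_adicCompletion {a : Ideal B} (ha : a ≤ maximalIdeal B) :
    a.map (algebraMap B (CompletedRing B)) ≤ maximalIdeal (CompletedRing B) := by
  rw [AdicCompletion.maximalIdeal_eq_map]
  exact Ideal.map_mono ha

lemma LC.nontrivial_map_iff (a : Ideal B) (d : ℕ) (q : Ideal (CompletedRing B)) :
    Nontrivial (LC (a.map (algebraMap B (CompletedRing B))) d (CompletedRing B ⧸ q)) ↔ Nontrivial (LC a d (CompletedRing B ⧸ q)) := by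
  rw [← not_subsingleton_iff_nontrivial, ← not_subsingleton_iff_nontrivial,
    LC.subsingleton_map_iff]

omit [IsNoetherianRing B] in
lemma smul_quotient_eq_zero {q : Ideal (CompletedRing B)} {P : Ideal B} (h : P.map (algebraMap B (CompletedRing B)) ≤ q) :
    ∀ r ∈ P, ∀ x : CompletedRing B ⧸ q, r • x = 0 := by
  intro r hr x
  obtain ⟨x, rfl⟩ := Ideal.Quotient.mk_surjective x
  rw [Algebra.smul_def]
  have : algebraMap B (CompletedRing B ⧸ q) r = 0 :=
    Ideal.Quotient.eq_zero_iff_mem.2 (h (Ideal.mem_map_of_mem _ hr))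
  rw [this, zero_mul]

lemma ringKrullDim_quotient_adicCompletion_le (q : Ideal (CompletedRing B)) [q.IsPrime] (P : Ideal B)
    (h : P.map (algebraMap B (CompletedRing B)) ≤ q) : ringKrullDim (CompletedRing B ⧸ q) ≤ ringKrullDim (B ⧸ P) := by
  obtain ⟨e, he⟩ : ∃ e : ℕ, ringKrullDim (CompletedRing B ⧸ q) = e := by
    have : IsLocalRing (CompletedRing B ⧸ q) :=
      IsLocalRing.of_surjective' _ Ideal.Quotient.mk_surjective
    obtain ⟨e, he⟩ := WithBot.ne_bot_iff_exists.1 (ringKrullDim_ne_bot (R := CompletedRing B ⧸ q))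
    have he' : e ≠ ⊤ := by
      rintro rfl
      exact ringKrullDim_ne_top (R := CompletedRing B ⧸ q) he.symm
    obtain ⟨e, rfl⟩ := ENat.ne_top_iff_exists.1 he'
    exact ⟨e, he.symm⟩
  rw [he]
  refine LC.le_ringKrullDim_of_nontrivial (maximalIdeal B) e P (CompletedRing B ⧸ q) (smul_quotient_eq_zero h) ?_
  rw [← LC.nontrivial_map_iff, ← AdicCompletion.maximalIdeal_eq_map]
  exact LC.nontrivial_of_pow_le _ e q le_rfl he 1 (by simp)

/-- A prime of the completion witnessing top dimension forces nonvanishing over the base. -/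
lemma LC.nontrivial_of_adicCompletion_prime (a : Ideal B) (ha : a ≤ maximalIdeal B) (d : ℕ)
    (q : Ideal (CompletedRing B)) [q.IsPrime] (P : Ideal B) (h : P.map (algebraMap B (CompletedRing B)) ≤ q)
    (hP : ringKrullDim (B ⧸ P) ≤ d) (hq : ringKrullDim (CompletedRing B ⧸ q) = d)
    (haq : ringKrullDim (CompletedRing B ⧸ (a.map (algebraMap B (CompletedRing B)) ⊔ q)) = (0 : WithBot ℕ∞)) :
    ringKrullDim (B ⧸ P) = d ∧ Nontrivial (LC a d (B ⧸ P)) := by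
  refine ⟨le_antisymm hP (hq ▸ ringKrullDim_quotient_adicCompletion_le q P h), ?_⟩
  obtain ⟨s, hs⟩ := exists_pow_le_of_ringKrullDim_le_zero _ haq.le
  by_contra hn
  rw [not_nontrivial_iff_subsingleton] at hn
  have h1 := LC.nontrivial_of_pow_le _ d q (map_le_maximalIdeal_adicCompletion ha) hq s hs
  rw [LC.nontrivial_map_iff] at h1
  exact not_subsingleton_iff_nontrivial.2 h1
    (LC.subsingleton_of_forall_smul_eq_zero a d P hP hn _ (smul_quotient_eq_zero h))

/-- Nonvanishing over the base is witnessed by a prime of the completion. -/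
lemma LC.exists_adicCompletion_prime (a : Ideal B) (ha : a ≤ maximalIdeal B) (d : ℕ)
    (P : Ideal B) (hP : ringKrullDim (B ⧸ P) ≤ d) (hn : Nontrivial (LC a d (B ⧸ P))) :
    ∃ q : Ideal (CompletedRing B), ∃ _ : q.IsPrime, P.map (algebraMap B (CompletedRing B)) ≤ q ∧ ringKrullDim (CompletedRing B ⧸ q) = d ∧
      ringKrullDim (CompletedRing B ⧸ (a.map (algebraMap B (CompletedRing B)) ⊔ q)) = (0 : WithBot ℕ∞) := by
  have : Module.Finite (CompletedRing B) (AdicCompletion (maximalIdeal B) (B ⧸ P)) :=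
    Module.Finite.equiv (AdicCompletion.ofTensorProductEquivOfFiniteNoetherian _ (B ⧸ P))
  by_contra! hcon
  refine not_subsingleton_iff_nontrivial.2 hn (LC.subsingleton_of_adicCompletion a d _ ?_)
  rw [← LC.subsingleton_map_iff (S := CompletedRing B)]
  refine LC.subsingleton_of_forall_prime _ d _ fun q hq hann => ?_
  rw [← not_nontrivial_iff_subsingleton]
  intro hnq
  have hPq : P.map (algebraMap B (CompletedRing B)) ≤ q := by
    refine le_trans ?_ hann
    rw [Ideal.map_le_iff_le_comap]
    intro r hr
    rw [Ideal.mem_comap, Module.mem_annihilator]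
    intro x
    rw [algebraMap_smul]
    ext n
    rw [AdicCompletion.val_smul_apply, AdicCompletion.val_zero_apply]
    obtain ⟨y, hy⟩ := Submodule.mkQ_surjective _ (x.val n)
    obtain ⟨z, rfl⟩ := Ideal.Quotient.mk_surjective y
    rw [← hy, ← map_smul, Algebra.smul_def, Ideal.Quotient.algebraMap_eq,
      Ideal.Quotient.eq_zero_iff_mem.2 hr, zero_mul, _root_.map_zero]
  obtain ⟨h1, s, hs⟩ := LC.exists_pow_le_of_nontrivial _ d q
    ((ringKrullDim_quotient_adicCompletion_le q P hPq).trans hP) hnq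
  refine hcon q hq hPq h1 ?_
  have hq' : q ≤ maximalIdeal (CompletedRing B) := le_maximalIdeal hq.ne_top
  have hle : a.map (algebraMap B (CompletedRing B)) ⊔ q ≤ maximalIdeal (CompletedRing B) :=
    sup_le (map_le_maximalIdeal_adicCompletion ha) hq'
  exact ringKrullDim_quotient_eq_zero_of_pow_le _ hle s hs

end Completion

section Global

open IsLocalRing

/-- Localization of a cyclic module. -/
noncomputable def localizedQuotientEquiv {R : Type} [CommRing R] (m : Ideal R) [m.IsPrime]
    (p : Ideal R) :
    LocalizedModule m.primeCompl (R ⧸ p) ≃ₗ[Localization.AtPrime m]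
      (Localization.AtPrime m ⧸ p.map (algebraMap R (Localization.AtPrime m))) :=
  (LocalizedModule.equivTensorProduct m.primeCompl (R ⧸ p)).trans
    (Algebra.TensorProduct.quotIdealMapEquivTensorQuot (Localization.AtPrime m) p).symm.toLinearEquiv

lemma mem_support_adicCompletion_iff {B : Type} [CommRing B] [IsNoetherianRing B] (I J : Ideal B)
    (M : Type) [AddCommGroup M] [Module B M] (e : M ≃ₗ[B] B ⧸ J)
    (q : PrimeSpectrum (AdicCompletion I B)) :
    q ∈ Module.support (AdicCompletion I B) (AdicCompletion I M) ↔
      J.map (algebraMap B (AdicCompletion I B)) ≤ q.asIdeal := by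
  have : Module.Finite B M := Module.Finite.equiv e.symm
  let e' : (AdicCompletion I B ⧸ J.map (algebraMap B (AdicCompletion I B))) ≃ₗ[AdicCompletion I B]
      AdicCompletion I M :=
    ((Algebra.TensorProduct.quotIdealMapEquivTensorQuot (AdicCompletion I B) J).toLinearEquiv.trans
      (e.symm.baseChange B (AdicCompletion I B) _ _)).trans
      (AdicCompletion.ofTensorProductEquivOfFiniteNoetherian I M)
  rw [← e'.support_eq, Module.support_eq_zeroLocus, Ideal.annihilator_quotient,
    PrimeSpectrum.mem_zeroLocus, SetLike.coe_subset_coe]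

lemma strictMono_zeroLocus_comap {R : Type} [CommRing R] (m : Ideal R) [m.IsPrime]
    (p : Ideal R) (P : Ideal (Localization.AtPrime m))
    (h : p ≤ P.comap (algebraMap R (Localization.AtPrime m))) :
    StrictMono (fun x : PrimeSpectrum.zeroLocus (P : Set (Localization.AtPrime m)) =>
      (⟨PrimeSpectrum.comap (algebraMap R (Localization.AtPrime m)) x.1,
        h.trans (Ideal.comap_mono x.2)⟩ : PrimeSpectrum.zeroLocus (p : Set R))) :=
  fun _ _ hxy =>
    (IsLocalization.orderEmbedding m.primeCompl (Localization.AtPrime m)).strictMono hxy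

lemma ringKrullDim_quotient_le_of_le_comap {R : Type} [CommRing R] (m : Ideal R) [m.IsPrime]
    (p : Ideal R) (P : Ideal (Localization.AtPrime m))
    (h : p ≤ P.comap (algebraMap R (Localization.AtPrime m))) :
    ringKrullDim (Localization.AtPrime m ⧸ P) ≤ ringKrullDim (R ⧸ p) := by
  rw [ringKrullDim_quotient, ringKrullDim_quotient]
  exact Order.krullDim_le_of_strictMono _ (strictMono_zeroLocus_comap m p P h)

lemma isMaximal_of_ringKrullDim_quotient_eq {R : Type} [CommRing R] (m : Ideal R) [m.IsPrime]
    (p : Ideal R) (P : Ideal (Localization.AtPrime m))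
    (h : p ≤ P.comap (algebraMap R (Localization.AtPrime m))) (d : ℕ)
    (hP : ringKrullDim (Localization.AtPrime m ⧸ P) = d) (hp : ringKrullDim (R ⧸ p) ≤ d) :
    m.IsMaximal := by
  by_contra hm
  obtain ⟨M, hM, hmM⟩ := Ideal.exists_le_maximal m (Ideal.IsPrime.ne_top inferInstance)
  have hlt : m < M := lt_of_le_of_ne hmM fun e => hm (e ▸ hM)
  rw [ringKrullDim_quotient] at hP hp
  obtain ⟨l, hl⟩ := Order.le_krullDim_iff.1 hP.ge
  have hsm := strictMono_zeroLocus_comap m p P h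
  have hle : ((l.map _ hsm).last).1.asIdeal ≤ m := by
    rw [LTSeries.last_map]
    have : l.last.1.asIdeal ≤ maximalIdeal (Localization.AtPrime m) :=
      le_maximalIdeal l.last.1.2.ne_top
    refine (Ideal.comap_mono this).trans ?_
    exact Localization.AtPrime.under_maximalIdeal.le
  let x : PrimeSpectrum.zeroLocus (p : Set R) :=
    ⟨⟨M, hM.isPrime⟩, ((l.map _ hsm).last).2.trans (hle.trans hmM)⟩
  have hx : (l.map _ hsm).last < x := lt_of_le_of_lt (b := (⟨⟨m, inferInstance⟩,
    ((l.map _ hsm).last).2.trans hle⟩ : PrimeSpectrum.zeroLocus (p : Set R))) hle hlt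
  have := Order.LTSeries.length_le_krullDim ((l.map _ hsm).snoc x hx)
  have := this.trans hp
  simp [hl] at this
  norm_cast at this
  omega

lemma nontrivial_topLC_of_cohDim_eq (B : Type) [CommRing B] [IsNoetherianRing B] (a : Ideal B)
    (M : Type) [AddCommGroup M] [Module B M] (d : ℕ) (h : cohDim B a M = (d : WithBot ℕ∞)) :
    Nontrivial (TopLC B a d M) := by
  by_contra hn
  rw [cohDim] at h
  have hlt : ∀ i : ℕ, Nontrivial (TopLC B a i M) → i < d := by
    intro i hi
    have : (i : WithBot ℕ∞) ≤ d := h ▸ le_sSup ⟨i, rfl, hi⟩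
    refine lt_of_le_of_ne (by exact_mod_cast this) ?_
    rintro rfl
    exact hn hi
  cases d with
  | zero =>
    have : sSup {n : WithBot ℕ∞ | ∃ i : ℕ, n = (i : ℕ) ∧ Nontrivial (TopLC B a i M)} ≤ ⊥ := by
      refine sSup_le ?_
      rintro _ ⟨i, rfl, hi⟩
      exact absurd (hlt i hi) (Nat.not_lt_zero i)
    rw [h] at this
    exact absurd this (by simp)
  | succ d =>
    have : sSup {n : WithBot ℕ∞ | ∃ i : ℕ, n = (i : ℕ) ∧ Nontrivial (TopLC B a i M)} ≤
        (d : WithBot ℕ∞) := by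
      refine sSup_le ?_
      rintro _ ⟨i, rfl, hi⟩
      exact_mod_cast Nat.le_of_lt_succ (hlt i hi)
    rw [h] at this
    have : d + 1 ≤ d := by exact_mod_cast this
    omega

lemma cohDim_eq_of_nontrivial (B : Type) [CommRing B] [IsNoetherianRing B] (a : Ideal B)
    (M : Type) [AddCommGroup M] [Module B M] [Module.Finite B M] (d : ℕ)
    (hd : Module.supportDim B M ≤ d) (h : Nontrivial (TopLC B a d M)) :
    cohDim B a M = (d : WithBot ℕ∞) := by
  refine le_antisymm (sSup_le ?_) (le_sSup ⟨d, rfl, h⟩)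
  rintro _ ⟨i, rfl, hi⟩
  rw [topLC_nontrivial_iff] at hi
  by_contra hlt
  exact not_subsingleton_iff_nontrivial.2 hi
    (LC.subsingleton_of_supportDim_lt a M i (hd.trans_lt (not_le.1 hlt)))

lemma LC.subsingleton_top {R : Type} [CommRing R] (i : ℕ) (M : Type) [AddCommGroup M]
    [Module R M] : Subsingleton (LC (⊤ : Ideal R) i M) := by
  refine subsingleton_of_forall_eq 0 fun x => ?_
  obtain ⟨n, hn⟩ := LC.exists_pow_smul_eq_zero x
  have := hn 1 (by rw [Ideal.top_pow]; trivial)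
  rwa [one_smul] at this

lemma mem_Assh_of_ringKrullDim_eq {R : Type} [CommRing R] [IsNoetherianRing R] (b p : Ideal R)
    [p.IsPrime] (d : ℕ) (hd : ringKrullDim (R ⧸ b) = d) (hb : b ≤ p)
    (hp : ringKrullDim (R ⧸ p) = d) : p ∈ Assh R (R ⧸ b) := by
  refine ⟨?_, hp.trans (hd.symm.trans (Module.supportDim_quotient_eq_ringKrullDim b).symm)⟩
  refine Module.associatedPrimes.minimalPrimes_annihilator_subset_associatedPrimes R (R ⧸ b) ?_
  rw [Ideal.annihilator_quotient]
  refine ⟨⟨inferInstance, hb⟩, ?_⟩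
  rintro p' ⟨hp', hbp'⟩ hle
  by_contra hne
  have h1 := ringKrullDim_add_one_le_of_lt (lt_of_le_not_ge hle hne)
  have h2 : ringKrullDim (R ⧸ p') ≤ d := hd ▸ ringKrullDim_le_of_surjective
    (Ideal.Quotient.factor hbp') (Ideal.Quotient.factor_surjective hbp')
  rw [hp] at h1
  have : d + 1 ≤ d := by exact_mod_cast h1.trans h2
  omega

end Global

section Main

open IsLocalRing

lemma topLC_nontrivial_localized_iff {R : Type} [CommRing R] (m : Ideal R) [m.IsPrime]
    (a : Ideal (Localization.AtPrime m)) (d : ℕ) (p : Ideal R) :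
    Nontrivial (TopLC (Localization.AtPrime m) a d (LocalizedModule m.primeCompl (R ⧸ p))) ↔
      Nontrivial (LC a d
        (Localization.AtPrime m ⧸ p.map (algebraMap R (Localization.AtPrime m)))) := by
  rw [topLC_nontrivial_iff]
  exact (LC.congr a d (localizedQuotientEquiv m p)).toEquiv.nontrivial_congr

lemma exists_of_mem_Pset {R : Type} [CommRing R] [IsNoetherianRing R] (a b : Ideal R)
    (d : ℕ) (hd : ringKrullDim (R ⧸ b) = (d : WithBot ℕ∞)) (m : PrimeSpectrum R)
    (hm : m ∈ Pset R a (R ⧸ b) d) :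
    m.asIdeal.IsMaximal ∧ ∃ p ∈ Assh R (R ⧸ b), p ≤ m.asIdeal ∧
      cohDim (Localization.AtPrime m.asIdeal)
        (a.map (algebraMap R (Localization.AtPrime m.asIdeal)))
        (LocalizedModule m.asIdeal.primeCompl (R ⧸ p)) = (d : WithBot ℕ∞) := by
  obtain ⟨ham, q, hq, hqd, haq⟩ := hm
  set B := Localization.AtPrime m.asIdeal
  rw [Ideal.annihilator_quotient] at ham
  rw [mem_support_adicCompletion_iff _ _ _ (localizedQuotientEquiv m.asIdeal b)] at hq
  let P : Ideal B := q.asIdeal.comap (algebraMap B (CompletedRing B))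
  let p : Ideal R := P.comap (algebraMap R B)
  have hP : P.IsPrime := Ideal.comap_isPrime _ _
  have hp : p.IsPrime := Ideal.comap_isPrime _ _
  have hbp : b ≤ p := Ideal.map_le_iff_le_comap.1 (Ideal.map_le_iff_le_comap.1 hq)
  have hpm : p ≤ m.asIdeal :=
    (Ideal.comap_mono (le_maximalIdeal hP.ne_top)).trans
      Localization.AtPrime.under_maximalIdeal.le
  have ha : a.map (algebraMap R B) ≤ maximalIdeal B :=
    Ideal.map_le_iff_le_comap.2 ((le_sup_right.trans ham).trans
      Localization.AtPrime.under_maximalIdeal.ge)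
  have hpd : ringKrullDim (R ⧸ p) ≤ d := hd ▸ ringKrullDim_le_of_surjective
    (Ideal.Quotient.factor hbp) (Ideal.Quotient.factor_surjective hbp)
  have hPp := ringKrullDim_quotient_le_of_le_comap m.asIdeal p P le_rfl
  obtain ⟨hPd, hn⟩ := LC.nontrivial_of_adicCompletion_prime _ ha d q.asIdeal P
    Ideal.map_comap_le (hPp.trans hpd) hqd haq
  have hmap : p.map (algebraMap R B) = P := IsLocalization.map_under m.asIdeal.primeCompl B P
  refine ⟨isMaximal_of_ringKrullDim_quotient_eq m.asIdeal p P le_rfl d hPd hpd, p,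
    mem_Assh_of_ringKrullDim_eq b p d hd hbp (le_antisymm hpd (hPd ▸ hPp)), hpm, ?_⟩
  refine cohDim_eq_of_nontrivial B _ _ d ?_ ?_
  · rw [Module.supportDim_eq_of_equiv (localizedQuotientEquiv m.asIdeal p),
      Module.supportDim_quotient_eq_ringKrullDim, hmap, hPd]
  · rw [topLC_nontrivial_localized_iff, hmap]
    exact hn

lemma mem_Pset_of_cohDim_eq {R : Type} [CommRing R] [IsNoetherianRing R] (a b : Ideal R)
    (d : ℕ) (hd : ringKrullDim (R ⧸ b) = (d : WithBot ℕ∞)) (m : PrimeSpectrum R) (p : Ideal R)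
    (hp : p ∈ Assh R (R ⧸ b)) (hpm : p ≤ m.asIdeal)
    (hc : cohDim (Localization.AtPrime m.asIdeal)
        (a.map (algebraMap R (Localization.AtPrime m.asIdeal)))
        (LocalizedModule m.asIdeal.primeCompl (R ⧸ p)) = (d : WithBot ℕ∞)) :
    m ∈ Pset R a (R ⧸ b) d := by
  set B := Localization.AtPrime m.asIdeal
  have hn := nontrivial_topLC_of_cohDim_eq B _ _ d hc
  rw [topLC_nontrivial_localized_iff] at hn
  have hbp : b ≤ p := by
    have := IsAssociatedPrime.annihilator_le hp.1
    rwa [Submodule.annihilator_top, Ideal.annihilator_quotient] at this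
  have hpd : ringKrullDim (R ⧸ p) = d :=
    hp.2.trans ((Module.supportDim_quotient_eq_ringKrullDim b).trans hd)
  have ha : a.map (algebraMap R B) ≤ maximalIdeal B := by
    refine le_maximalIdeal fun h => ?_
    rw [h] at hn
    exact not_subsingleton_iff_nontrivial.2 hn (LC.subsingleton_top d _)
  have ham : a ≤ m.asIdeal :=
    (Ideal.map_le_iff_le_comap.1 ha).trans Localization.AtPrime.under_maximalIdeal.le
  obtain ⟨q, hq, hpq, hqd, haq⟩ := LC.exists_adicCompletion_prime _ ha d
    (p.map (algebraMap R B))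
    ((ringKrullDim_quotient_le_of_le_comap m.asIdeal p _ Ideal.le_comap_map).trans hpd.le) hn
  refine ⟨?_, ⟨q, hq⟩, ?_, hqd, haq⟩
  · rw [Ideal.annihilator_quotient]
    exact sup_le (hbp.trans hpm) ham
  · rw [mem_support_adicCompletion_iff _ _ _ (localizedQuotientEquiv m.asIdeal b)]
    exact (Ideal.map_mono (Ideal.map_mono hbp)).trans hpq

end Main

end LocCoh

end LocalCohomologyTheory

/-- For ideals `a`, `b` of a Noetherian ring `R` with `dim R/b = d` finite,
`P_{a,R/b}` equals the set of maximal ideals `m` for which there is `p ∈ Assh_R(R/b)` with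
`p ⊆ m` and `cd_{R_m}(a R_m, R_m/p R_m) = d`. -/
theorem stmt_6 (R : Type) [CommRing R] [IsNoetherianRing R] (a b : Ideal R)
    (d : ℕ) (hd : ringKrullDim (R ⧸ b) = (d : WithBot ℕ∞)) :
    Pset R a (R ⧸ b) d =
      { m : PrimeSpectrum R | m.asIdeal.IsMaximal ∧
        ∃ p ∈ Assh R (R ⧸ b), p ≤ m.asIdeal ∧
          cohDim (Localization.AtPrime m.asIdeal)
              (a.map (algebraMap R (Localization.AtPrime m.asIdeal)))
              (LocalizedModule m.asIdeal.primeCompl (R ⧸ p)) = (d : WithBot ℕ∞) } := by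
  ext m
  constructor
  · exact LocCoh.exists_of_mem_Pset a b d hd m
  · rintro ⟨-, p, hp, hpm, hc⟩
    exact LocCoh.mem_Pset_of_cohDim_eq a b d hd m p hp hpm hc
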